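/- arXiv:2409.08061 — 3 statements merged into one kernel-verified Lean document; each statement's English description precedes it below -/
import Mathlib

section
/- Under the standing assumptions, for every δ > 0 there exist c > 0 and C > 0 such that for every t > 1: ∬_{ℝ×ℝ} max(1, t|s₁ − s₂|)^{−δ} dσ(s₁) dσ(s₂) ≤ C t^{−c}. -/
open MeasureTheory Filter Topology

/-- The group of orientation-preserving affine maps of ℝ, modeled as pairs `(r, b)`
with `r > 0`, acting by `t ↦ r * t + b`. -/
abbrev AffP : Type := {p : ℝ × ℝ // 0 < p.1}

/-- The topological support of a measure. -/
def msupport {α : Type*} [TopologicalSpace α] [MeasurableSpace α] (μ : Measure α) : Set α :=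
  {x | ∀ U : Set α, IsOpen U → x ∈ U → 0 < μ U}

namespace CorrelationDecay

open Set
open scoped ENNReal

/-! ### Elementary inequalities in `ℝ≥0∞` -/

lemma mul_le_weighted_sq (e a b : ℝ≥0∞) (he : e ≠ 0) (he' : e ≠ ⊤) :
    2 * (a * b) ≤ e * a ^ 2 + e⁻¹ * b ^ 2 := by
  rcases eq_or_ne a ⊤ with rfl | ha
  · simp [ENNReal.mul_top, he]
  rcases eq_or_ne b ⊤ with rfl | hb
  · simp [ENNReal.mul_top, he']
  lift e to NNReal using he'
  lift a to NNReal using ha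
  lift b to NNReal using hb
  have he0 : e ≠ 0 := by simpa using he
  rw [← ENNReal.coe_inv he0]
  norm_cast
  rw [← NNReal.coe_le_coe]
  push_cast
  have hpos : (0 : ℝ) < e := by positivity
  have key : (e : ℝ) * a ^ 2 + (e : ℝ)⁻¹ * b ^ 2 - 2 * (a * b) = (e : ℝ)⁻¹ * (e * a - b) ^ 2 := by
    field_simp
    ring
  have : 0 ≤ (e : ℝ)⁻¹ * (e * a - b) ^ 2 := by positivity
  linarith

lemma two_mul_le_sq (a b : ℝ≥0∞) : 2 * (a * b) ≤ a ^ 2 + b ^ 2 := by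
  simpa using mul_le_weighted_sq 1 a b one_ne_zero ENNReal.one_ne_top

lemma add_sq_le_two (a b : ℝ≥0∞) : (a + b) ^ 2 ≤ 2 * a ^ 2 + 2 * b ^ 2 := by
  calc (a + b) ^ 2 = a ^ 2 + b ^ 2 + 2 * (a * b) := by ring
    _ ≤ a ^ 2 + b ^ 2 + (a ^ 2 + b ^ 2) := by gcongr; exact two_mul_le_sq a b
    _ = _ := by ring

lemma sq_lintegral_le {α : Type*} [MeasurableSpace α] (P : Measure α) [IsProbabilityMeasure P]
    {F : α → ℝ≥0∞} (hF : Measurable F) : (∫⁻ a, F a ∂P) ^ 2 ≤ ∫⁻ a, F a ^ 2 ∂P := by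
  have h := ENNReal.lintegral_mul_le_Lp_mul_Lq P Real.HolderConjugate.two_two
    hF.aemeasurable (measurable_const (a := (1 : ℝ≥0∞))).aemeasurable
  simp only [Pi.mul_apply, mul_one, ENNReal.one_rpow, lintegral_const, measure_univ] at h
  calc (∫⁻ a, F a ∂P) ^ 2 ≤ ((∫⁻ a, F a ^ (2 : ℝ) ∂P) ^ (1 / 2 : ℝ)) ^ 2 := by gcongr
    _ = ∫⁻ a, F a ^ (2 : ℝ) ∂P := by
        rw [← ENNReal.rpow_natCast, ← ENNReal.rpow_mul]; norm_num
    _ = _ := by simp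

/-! ### Windowed energy of a measure -/

/-- The squared `L²` norm, at scale `h`, of `μ` convolved with a window of length `h`. -/
noncomputable def energy (μ : Measure ℝ) (h : ℝ) : ℝ≥0∞ :=
  (∫⁻ y, μ (Icc y (y + h)) ^ 2) / ENNReal.ofReal h

lemma measurable_window (μ : Measure ℝ) [SFinite μ] (h : ℝ) :
    Measurable fun y => μ (Icc y (y + h)) := by
  have hs : MeasurableSet {z : ℝ × ℝ | z.1 ≤ z.2 ∧ z.2 ≤ z.1 + h} :=
    (measurableSet_le measurable_fst measurable_snd).inter
      (measurableSet_le measurable_snd (measurable_fst.add_const h))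
  exact measurable_measure_prodMk_left hs

lemma lintegral_sq_window (μ : Measure ℝ) [SFinite μ] (h : ℝ) :
    ∫⁻ y, μ (Icc y (y + h)) ^ 2 = ∫⁻ x, ∫⁻ x', ENNReal.ofReal (h - |x - x'|) ∂μ ∂μ := by
  have hs : MeasurableSet {z : (ℝ × ℝ) × ℝ | z.2 ≤ z.1.1 ∧ z.1.1 ≤ z.2 + h ∧
      z.2 ≤ z.1.2 ∧ z.1.2 ≤ z.2 + h} := by
    measurability
  have h1 : ∀ y, μ (Icc y (y + h)) ^ 2 =
      (μ.prod μ) ((fun p : ℝ × ℝ => (p, y)) ⁻¹' {z : (ℝ × ℝ) × ℝ | z.2 ≤ z.1.1 ∧ z.1.1 ≤ z.2 + h ∧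
      z.2 ≤ z.1.2 ∧ z.1.2 ≤ z.2 + h}) := by
    intro y
    rw [sq, ← Measure.prod_prod]
    congr 1
    ext p
    simp only [mem_preimage, mem_ofPred_eq, mem_prod, mem_Icc]
    tauto
  have h2 : ∀ p : ℝ × ℝ, volume (Prod.mk p ⁻¹' {z : (ℝ × ℝ) × ℝ | z.2 ≤ z.1.1 ∧ z.1.1 ≤ z.2 + h ∧
      z.2 ≤ z.1.2 ∧ z.1.2 ≤ z.2 + h}) = ENNReal.ofReal (h - |p.1 - p.2|) := by
    intro p
    have : Prod.mk p ⁻¹' {z : (ℝ × ℝ) × ℝ | z.2 ≤ z.1.1 ∧ z.1.1 ≤ z.2 + h ∧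
      z.2 ≤ z.1.2 ∧ z.1.2 ≤ z.2 + h} = Icc (max p.1 p.2 - h) (min p.1 p.2) := by
      ext y
      simp only [mem_preimage, mem_ofPred_eq, mem_Icc, sub_le_iff_le_add, max_le_iff, le_min_iff]
      tauto
    rw [this, Real.volume_Icc, ← max_sub_min_eq_abs']
    congr 1; ring
  simp_rw [h1]
  rw [← Measure.prod_apply_symm hs, Measure.prod_apply hs]
  simp_rw [h2]
  rw [lintegral_prod _ (by fun_prop)]

lemma energy_eq_kernel (μ : Measure ℝ) [SFinite μ] {h : ℝ} (hh : 0 < h) :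
    energy μ h = ∫⁻ x, ∫⁻ x', ENNReal.ofReal (1 - |x - x'| / h) ∂μ ∂μ := by
  rw [energy, lintegral_sq_window, ENNReal.div_eq_inv_mul,
    ← lintegral_const_mul' _ _ (by simp [hh])]
  congr with x
  rw [← lintegral_const_mul' _ _ (by simp [hh])]
  congr with x'
  rw [← ENNReal.ofReal_inv_of_pos hh, ← ENNReal.ofReal_mul (by positivity)]
  congr 1
  field_simp

lemma energy_mono (μ : Measure ℝ) [SFinite μ] {h k : ℝ} (hh : 0 < h) (hk : h ≤ k) :
    energy μ h ≤ energy μ k := by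
  rw [energy_eq_kernel μ hh, energy_eq_kernel μ (hh.trans_le hk)]
  gcongr

lemma energy_le_sq (μ : Measure ℝ) [SFinite μ] {h : ℝ} (hh : 0 < h) :
    energy μ h ≤ μ univ ^ 2 := by
  rw [energy_eq_kernel μ hh]
  calc _ ≤ ∫⁻ x, ∫⁻ x', 1 ∂μ ∂μ := by
        gcongr with x x'
        rw [ENNReal.ofReal_le_one]
        have : 0 ≤ |x - x'| / h := by positivity
        linarith
    _ = _ := by simp [sq]

/-! ### Affine maps and stationary measures -/

/-- The action of an affine map on the line. -/
def act (φ : AffP) (x : ℝ) : ℝ := φ.1.1 * x + φ.1.2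

/-- Composition of affine maps. -/
def comp (φ ψ : AffP) : AffP :=
  ⟨(φ.1.1 * ψ.1.1, φ.1.1 * ψ.1.2 + φ.1.2), mul_pos φ.2 ψ.2⟩

lemma act_comp (φ ψ : AffP) (x : ℝ) : act (comp φ ψ) x = act φ (act ψ x) := by
  simp [act, comp]; ring

lemma continuous_act : Continuous fun z : AffP × ℝ => act z.1 z.2 := by
  unfold act; fun_prop

lemma continuous_comp : Continuous fun z : AffP × AffP => comp z.1 z.2 := by
  unfold comp
  refine Continuous.subtype_mk ?_ _
  fun_prop

@[fun_prop]
lemma measurable_act {α : Type*} [MeasurableSpace α] {f : α → AffP} {g : α → ℝ}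
    (hf : Measurable f) (hg : Measurable g) : Measurable fun a => act (f a) (g a) := by
  unfold act; fun_prop

lemma measurable_comp : Measurable fun z : AffP × AffP => comp z.1 z.2 := by
  unfold comp
  refine Measurable.subtype_mk ?_
  fun_prop

/-- `σ` is stationary for the law `P` on affine maps. -/
def Stationary (P : Measure AffP) (σ : Measure ℝ) : Prop :=
  ∀ f : ℝ → ℝ≥0∞, Measurable f → ∫⁻ x, f x ∂σ = ∫⁻ φ, ∫⁻ x, f (act φ x) ∂σ ∂P

lemma stationary_of_sets {P : Measure AffP} {σ : Measure ℝ} [SFinite P] [SFinite σ]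
    (h : ∀ A : Set ℝ, MeasurableSet A → σ A = ∫⁻ φ : AffP, σ (act φ ⁻¹' A) ∂P) :
    Stationary P σ := by
  have hm : Measurable fun z : AffP × ℝ => act z.1 z.2 := by fun_prop
  have key : σ = (P.prod σ).map fun z => act z.1 z.2 := by
    ext A hA
    rw [h A hA, Measure.map_apply hm hA, Measure.prod_apply (hm hA)]
    rfl
  intro f hf
  conv_lhs => rw [key]
  rw [lintegral_map hf hm, lintegral_prod _ (by fun_prop)]

/-- The law of the composition of two independent affine maps. -/
noncomputable def conv (P Q : Measure AffP) : Measure AffP :=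
  (P.prod Q).map fun z => comp z.1 z.2

instance (P Q : Measure AffP) [IsProbabilityMeasure P] [IsProbabilityMeasure Q] :
    IsProbabilityMeasure (conv P Q) :=
  Measure.isProbabilityMeasure_map measurable_comp.aemeasurable

lemma lintegral_conv (P Q : Measure AffP) [SFinite P] [SFinite Q] {f : AffP → ℝ≥0∞}
    (hf : Measurable f) : ∫⁻ φ, f φ ∂(conv P Q) = ∫⁻ φ, ∫⁻ ψ, f (comp φ ψ) ∂Q ∂P := by
  rw [conv, lintegral_map hf measurable_comp]
  exact lintegral_prod _ (hf.comp measurable_comp).aemeasurable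

lemma Stationary.conv {P Q : Measure AffP} [SFinite P] [SFinite Q] {σ : Measure ℝ} [SFinite σ]
    (hP : Stationary P σ) (hQ : Stationary Q σ) : Stationary (conv P Q) σ := by
  intro f hf
  have hm : Measurable fun φ : AffP => ∫⁻ x, f (act φ x) ∂σ :=
    Measurable.lintegral_prod_right' (f := fun z : AffP × ℝ => f (act z.1 z.2)) (by fun_prop)
  rw [lintegral_conv P Q hm, hP f hf]
  congr with φ
  simp_rw [act_comp]
  exact hQ (fun x => f (act φ x)) (by fun_prop)

/-- The identity affine map. -/
def one : AffP := ⟨(1, 0), one_pos⟩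

/-- Convolution powers of a law on affine maps. -/
noncomputable def convPow (P : Measure AffP) : ℕ → Measure AffP
  | 0 => Measure.dirac one
  | n + 1 => conv P (convPow P n)

instance (P : Measure AffP) [IsProbabilityMeasure P] (n : ℕ) :
    IsProbabilityMeasure (convPow P n) := by
  induction n with
  | zero => unfold convPow; infer_instance
  | succ n ih => unfold convPow; infer_instance

lemma Stationary.convPow {P : Measure AffP} [IsProbabilityMeasure P] {σ : Measure ℝ} [SFinite σ]
    (hP : Stationary P σ) (n : ℕ) : Stationary (convPow P n) σ := by
  induction n with
  | zero =>
    intro f hf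
    simp [CorrelationDecay.convPow, act, one]
  | succ n ih => exact hP.conv ih

lemma comp_mem_msupport {P Q : Measure AffP} [SFinite P] [SFinite Q] {φ ψ : AffP}
    (hφ : φ ∈ msupport P) (hψ : ψ ∈ msupport Q) : comp φ ψ ∈ msupport (conv P Q) := by
  intro U hU hmem
  have hV : IsOpen ((fun z : AffP × AffP => comp z.1 z.2) ⁻¹' U) := hU.preimage continuous_comp
  obtain ⟨A, B, hA, hB, hφA, hψB, hAB⟩ := isOpen_prod_iff.1 hV φ ψ hmem
  rw [conv, Measure.map_apply measurable_comp hU.measurableSet]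
  calc 0 < P A * Q B := ENNReal.mul_pos (hφ A hA hφA).ne' (hψ B hB hψB).ne'
    _ = (P.prod Q) (A ×ˢ B) := (Measure.prod_prod _ _).symm
    _ ≤ _ := measure_mono hAB

/-- Iterates of an affine map under composition. -/
def iter (φ : AffP) : ℕ → AffP
  | 0 => one
  | n + 1 => comp φ (iter φ n)

lemma iter_mem_msupport {P : Measure AffP} [IsProbabilityMeasure P] {φ : AffP}
    (hφ : φ ∈ msupport P) (n : ℕ) : iter φ n ∈ msupport (convPow P n) := by
  induction n with
  | zero =>
    intro U hU h
    simp only [iter] at h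
    simp [convPow, hU.measurableSet, h]
  | succ n ih => exact comp_mem_msupport hφ ih

lemma act_iter (φ : AffP) (n : ℕ) : act (iter φ n) = (act φ)^[n] := by
  induction n with
  | zero => ext x; simp [iter, act, one]
  | succ n ih =>
    ext x
    rw [Function.iterate_succ_apply', iter, act_comp, ih]

/-! ### Energy inequalities from stationarity -/

@[fun_prop]
lemma measurable_lintegral_act {σ : Measure ℝ} [SFinite σ] {f : ℝ → ℝ≥0∞} (hf : Measurable f) :
    Measurable fun φ : AffP => ∫⁻ x, f (act φ x) ∂σ :=
  Measurable.lintegral_prod_right' (f := fun z : AffP × ℝ => f (act z.1 z.2)) (by fun_prop)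

lemma measurable_window_act (μ : Measure ℝ) [SFinite μ] (h : ℝ) :
    Measurable fun z : AffP × ℝ => μ (act z.1 ⁻¹' Icc z.2 (z.2 + h)) := by
  have hs : MeasurableSet {z : (AffP × ℝ) × ℝ |
      z.1.2 ≤ act z.1.1 z.2 ∧ act z.1.1 z.2 ≤ z.1.2 + h} := by
    have ha : Measurable fun z : (AffP × ℝ) × ℝ => act z.1.1 z.2 := by fun_prop
    exact (measurableSet_le (by fun_prop) ha).inter (measurableSet_le ha (by fun_prop))
  exact measurable_measure_prodMk_left hs

lemma measurable_window_act_right (μ : Measure ℝ) [SFinite μ] (φ : AffP) (h : ℝ) :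
    Measurable fun y => μ (act φ ⁻¹' Icc y (y + h)) := by
  have hφ : Measurable fun y : ℝ => (φ, y) := measurable_prodMk_left
  exact (measurable_window_act μ h).comp hφ

lemma lintegral_affine (F : ℝ → ℝ≥0∞) (φ : AffP) :
    ∫⁻ y, F ((y - φ.1.2) / φ.1.1) = ENNReal.ofReal φ.1.1 * ∫⁻ z, F z := by
  have hr : 0 < φ.1.1 := φ.2
  have h1 : ∫⁻ y, F ((y - φ.1.2) / φ.1.1) = ∫⁻ y, F (φ.1.1⁻¹ * y) := by
    simp_rw [div_eq_inv_mul]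
    exact lintegral_sub_right_eq_self (fun y => F (φ.1.1⁻¹ * y)) φ.1.2
  have h2 := Real.map_volume_mul_left (inv_pos.2 hr).ne'
  rw [inv_inv, abs_of_pos hr] at h2
  rw [h1, ← smul_eq_mul, ← lintegral_smul_measure, ← h2]
  exact (lintegral_map_equiv F
    (Homeomorph.mulLeft₀ φ.1.1⁻¹ (inv_pos.2 hr).ne').toMeasurableEquiv).symm

lemma lintegral_sq_window_act (μ : Measure ℝ) (φ : AffP) {h : ℝ} (hh : 0 < h) :
    ∫⁻ y, μ (act φ ⁻¹' Icc y (y + h)) ^ 2 = ENNReal.ofReal h * energy μ (h / φ.1.1) := by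
  have hr : 0 < φ.1.1 := φ.2
  have h1 : ∀ y, act φ ⁻¹' Icc y (y + h) =
      Icc ((y - φ.1.2) / φ.1.1) ((y - φ.1.2) / φ.1.1 + h / φ.1.1) := by
    intro y
    ext x
    simp only [act, mem_preimage, mem_Icc, ← add_div, div_le_iff₀ hr, le_div_iff₀ hr]
    constructor <;> rintro ⟨h1, h2⟩ <;> constructor <;> linarith
  simp_rw [h1]
  rw [lintegral_affine (fun z => μ (Icc z (z + h / φ.1.1)) ^ 2) φ, energy,
    ENNReal.ofReal_div_of_pos hr, div_eq_mul_inv (∫⁻ _, _), ENNReal.inv_div (by simp) (by simp [hr]),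
    mul_comm (∫⁻ _, _), ← mul_assoc, ENNReal.mul_div_cancel (by simp [hh]) (by simp)]

lemma energy_mul_ofReal (μ : Measure ℝ) {h : ℝ} (hh : 0 < h) :
    ∫⁻ y, μ (Icc y (y + h)) ^ 2 = ENNReal.ofReal h * energy μ h := by
  rw [energy, ENNReal.mul_div_cancel (by simp [hh]) (by simp)]

lemma energy_le_of_window_le {P : Measure AffP} [IsProbabilityMeasure P] {μ : Measure ℝ}
    {h : ℝ} {G : AffP → ℝ → ℝ≥0∞} (hG : Measurable (Function.uncurry G))
    (hle : ∀ y, μ (Icc y (y + h)) ≤ ∫⁻ φ, G φ y ∂P) {E : AffP → ℝ≥0∞}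
    (hE : ∀ φ, ∫⁻ y, G φ y ^ 2 ≤ ENNReal.ofReal h * E φ) :
    energy μ h ≤ ∫⁻ φ, E φ ∂P := by
  rw [energy]
  refine ENNReal.div_le_of_le_mul' ?_
  calc ∫⁻ y, μ (Icc y (y + h)) ^ 2 ≤ ∫⁻ y, ∫⁻ φ, G φ y ^ 2 ∂P := by
        refine lintegral_mono fun y => ?_
        refine (pow_le_pow_left' (hle y) 2).trans (sq_lintegral_le P ?_)
        exact hG.comp measurable_prodMk_right
    _ = ∫⁻ φ, (∫⁻ y, G φ y ^ 2) ∂P :=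
        lintegral_lintegral_swap ((hG.comp measurable_swap).pow_const 2).aemeasurable
    _ ≤ ∫⁻ φ, ENNReal.ofReal h * E φ ∂P := lintegral_mono hE
    _ = _ := lintegral_const_mul' _ _ (by simp)

lemma Stationary.measure_eq {P : Measure AffP} {σ : Measure ℝ} (hs : Stationary P σ)
    {A : Set ℝ} (hA : MeasurableSet A) : σ A = ∫⁻ φ, σ (act φ ⁻¹' A) ∂P := by
  rw [← lintegral_indicator_one hA, hs _ (measurable_one.indicator hA)]
  congr with φ
  have : MeasurableSet (act φ ⁻¹' A) := (by fun_prop : Measurable (act φ)) hA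
  rw [← lintegral_indicator_one this]
  rfl

lemma Stationary.energy_le {P : Measure AffP} [IsProbabilityMeasure P] {σ : Measure ℝ}
    [SFinite σ] (hs : Stationary P σ) {h : ℝ} (hh : 0 < h) :
    energy σ h ≤ ∫⁻ φ, energy σ (h / φ.1.1) ∂P :=
  energy_le_of_window_le (G := fun φ y => σ (act φ ⁻¹' Icc y (y + h)))
    (measurable_window_act σ h) (fun _ => (hs.measure_eq measurableSet_Icc).le)
    fun φ => (lintegral_sq_window_act σ φ hh).le

/-! ### The drift is negative -/

lemma monotone_window_le {β : ℝ → ℝ} (hβ : Monotone β) {T : ℝ} (x : ℝ) :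
    (∫ s in (-T)..T, β (s - x)) - ∫ s in (-T)..T, β s ≤ x * (β (-T) - β (T - x)) := by
  have hi : ∀ a b, IntervalIntegrable β volume a b := fun a b => hβ.intervalIntegrable
  rw [intervalIntegral.integral_comp_sub_right,
    intervalIntegral.integral_interval_sub_interval_comm (hi _ _) (hi _ _) (hi _ _)]
  have h1 : ∫ s in (-T - x)..(-T), β s ≤ x * β (-T) := by
    rcases le_total 0 x with hx | hx
    · have := intervalIntegral.integral_mono_on (a := -T - x) (b := -T) (by linarith) (hi _ _)
        (intervalIntegrable_const (c := β (-T))) fun s hs => hβ hs.2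
      simpa using this
    · have := intervalIntegral.integral_mono_on (a := -T) (b := -T - x) (by linarith)
        (intervalIntegrable_const (c := β (-T))) (hi _ _) fun s hs => hβ hs.1
      rw [intervalIntegral.integral_symm]
      simp at this
      linarith
  have h2 : x * β (T - x) ≤ ∫ s in (T - x)..T, β s := by
    rcases le_total 0 x with hx | hx
    · have := intervalIntegral.integral_mono_on (a := T - x) (b := T) (by linarith)
        (intervalIntegrable_const (c := β (T - x))) (hi _ _) fun s hs => hβ hs.1
      simpa using this
    · have := intervalIntegral.integral_mono_on (a := T) (b := T - x) (by linarith) (hi _ _)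
        (intervalIntegrable_const (c := β (T - x))) fun s hs => hβ hs.2
      rw [intervalIntegral.integral_symm]
      simp at this
      linarith
  linarith

/-- A bounded monotone function which is subharmonic for a random walk with nonpositive drift
is harmonic almost everywhere. -/
lemma ae_harmonic_of_subharmonic {Ω : Type*} [MeasurableSpace Ω] (P : Measure Ω)
    [IsProbabilityMeasure P] {X : Ω → ℝ} (hXm : Measurable X) (hX : Integrable X P)
    (hX0 : 0 ≤ ∫ ω, X ω ∂P) {β : ℝ → ℝ} (hβ : Monotone β) (h0 : ∀ s, 0 ≤ β s) (h1 : ∀ s, β s ≤ 1)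
    (hsub : ∀ s, β s ≤ ∫ ω, β (s - X ω) ∂P) :
    ∀ᵐ s, β s = ∫ ω, β (s - X ω) ∂P := by
  have hβm : Measurable β := hβ.measurable
  have hnorm : ∀ s, ‖β s‖ ≤ 1 := fun s => by
    rw [Real.norm_eq_abs, abs_le]; constructor <;> linarith [h0 s, h1 s]
  have hjm : StronglyMeasurable fun z : ℝ × Ω => β (z.1 - X z.2) :=
    (by fun_prop : Measurable fun z : ℝ × Ω => β (z.1 - X z.2)).stronglyMeasurable
  set Q : ℝ → ℝ := fun s => ∫ ω, β (s - X ω) ∂P with hQ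
  have hQm : StronglyMeasurable Q := hjm.integral_prod_right'
  have hQb : ∀ s, ‖Q s‖ ≤ 1 := fun s => by
    refine (norm_integral_le_of_norm_le_const (C := 1) (ae_of_all _ fun _ => hnorm _)).trans ?_
    simp
  have hQi : ∀ a b, IntervalIntegrable Q volume a b := fun a b => by
    refine (intervalIntegrable_const (c := (1 : ℝ))).mono_fun hQm.aestronglyMeasurable ?_
    exact ae_of_all _ fun s => by simpa using hQb s
  have hβi : ∀ a b, IntervalIntegrable β volume a b := fun a b => hβ.intervalIntegrable
  set err : ℝ → ℝ := fun T => ∫ ω, X ω * (β (-T) - β (T - X ω)) ∂P with herr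
  have hbdd : ∀ T, ∫ s in (-T)..T, (Q s - β s) ≤ err T := by
    intro T
    have hji : Integrable (Function.uncurry fun s ω => β (s - X ω))
        ((volume.restrict (uIoc (-T) T)).prod P) := by
      have : IsFiniteMeasure (volume.restrict (uIoc (-T) T)) :=
        ⟨by simp [uIoc]⟩
      exact Integrable.of_bound hjm.aestronglyMeasurable 1 (ae_of_all _ fun z => hnorm _)
    have hsw := intervalIntegral_integral_swap (a := -T) (b := T) hji
    have hin : Integrable (fun ω => ∫ s in (-T)..T, β (s - X ω)) P := by
      have := hji.integral_prod_right
      simp only [Function.uncurry] at this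
      simp_rw [intervalIntegral.intervalIntegral_eq_integral_uIoc]
      simpa only [smul_eq_mul] using this.const_mul (if -T ≤ T then (1 : ℝ) else -1)
    have hein : Integrable (fun ω => X ω * (β (-T) - β (T - X ω))) P := by
      refine hX.mul_bdd (c := 2) ?_ (ae_of_all _ fun ω => ?_)
      · exact (by fun_prop : Measurable fun ω => β (-T) - β (T - X ω)).aestronglyMeasurable
      · rw [Real.norm_eq_abs, abs_le]
        constructor <;> linarith [h0 (-T), h1 (-T), h0 (T - X ω), h1 (T - X ω)]
    calc ∫ s in (-T)..T, (Q s - β s)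
        = ∫ ω, ((∫ s in (-T)..T, β (s - X ω)) - ∫ s in (-T)..T, β s) ∂P := by
          rw [intervalIntegral.integral_sub (hQi _ _) (hβi _ _),
            integral_sub hin (integrable_const _), ← hsw]
          simp [hQ]
      _ ≤ err T := integral_mono (hin.sub (integrable_const _)) hein
          fun ω => monotone_window_le hβ (X ω)
  have hlim : ∃ L ≤ 0, Tendsto err atTop (𝓝 L) := by
    have hbb : BddBelow (range β) := ⟨0, by rintro _ ⟨s, rfl⟩; exact h0 s⟩
    have hba : BddAbove (range β) := ⟨1, by rintro _ ⟨s, rfl⟩; exact h1 s⟩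
    have hm := tendsto_atBot_ciInf hβ hbb
    have hp := tendsto_atTop_ciSup hβ hba
    refine ⟨∫ ω, X ω * ((⨅ s, β s) - ⨆ s, β s) ∂P, ?_, ?_⟩
    · rw [integral_mul_const]
      refine mul_nonpos_of_nonneg_of_nonpos hX0 ?_
      have := (ciInf_le hbb 0).trans (le_ciSup hba 0)
      linarith
    · refine tendsto_integral_filter_of_dominated_convergence (fun ω => |X ω|)
        (Eventually.of_forall fun T => by
          exact (by fun_prop : Measurable fun ω => X ω * (β (-T) - β (T - X ω))).aestronglyMeasurable)
        (Eventually.of_forall fun T => ae_of_all _ fun ω => ?_) hX.abs (ae_of_all _ fun ω => ?_)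
      · rw [norm_mul, Real.norm_eq_abs]
        refine mul_le_of_le_one_right (abs_nonneg _) ?_
        rw [Real.norm_eq_abs, abs_le]
        constructor <;> linarith [h0 (-T), h1 (-T), h0 (T - X ω), h1 (T - X ω)]
      · refine Tendsto.const_mul _ (Tendsto.sub (hm.comp tendsto_neg_atTop_atBot) (hp.comp ?_))
        exact tendsto_atTop_add_const_right _ _ tendsto_id
  obtain ⟨L, hL, hlim⟩ := hlim
  have hzero : ∀ n : ℕ, ∫ s in (-(n : ℝ))..n, (Q s - β s) ≤ 0 := by
    intro n
    refine (ge_of_tendsto hlim ?_).trans hL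
    filter_upwards [eventually_ge_atTop (n : ℝ)] with T hT
    refine le_trans ?_ (hbdd T)
    have hn : (0 : ℝ) ≤ n := n.cast_nonneg
    refine intervalIntegral.integral_mono_interval (by linarith) (by linarith) hT
      (ae_of_all _ fun s => sub_nonneg.2 (hsub s)) ((hQi _ _).sub (hβi _ _))
  have hae : ∀ n : ℕ, ∀ᵐ s, s ∈ Ioc (-(n : ℝ)) n → Q s - β s = 0 := by
    intro n
    rw [← ae_restrict_iff' measurableSet_Ioc]
    have hn : (0 : ℝ) ≤ n := n.cast_nonneg
    have hz := hzero n
    rw [intervalIntegral.integral_of_le (by linarith)] at hz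
    refine (integral_eq_zero_iff_of_nonneg (fun s => sub_nonneg.2 (hsub s)) ?_).1
      (le_antisymm hz (integral_nonneg fun s => sub_nonneg.2 (hsub s)))
    exact ((hQi _ _).sub (hβi _ _)).1
  rw [← ae_all_iff] at hae
  filter_upwards [hae] with s hs
  obtain ⟨n, hn⟩ := exists_nat_gt |s|
  have := hs n ⟨by linarith [neg_abs_le s], by linarith [le_abs_self s]⟩
  linarith

lemma ae_eq_of_sq_lintegral_eq {α : Type*} [MeasurableSpace α] (P : Measure α)
    [IsProbabilityMeasure P] {F : α → ℝ≥0∞} (hF : Measurable F) (hF1 : ∀ a, F a ≤ 1)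
    (h : (∫⁻ a, F a ∂P) ^ 2 = ∫⁻ a, F a ^ 2 ∂P) : ∀ᵐ a ∂P, F a = ∫⁻ b, F b ∂P := by
  have hfin : ∀ a, F a ≠ ⊤ := fun a => ((hF1 a).trans_lt ENNReal.one_lt_top).ne
  set f : α → ℝ := fun a => (F a).toReal with hf
  have hfm : Measurable f := hF.ennreal_toReal
  have hf1 : ∀ a, f a ≤ 1 := fun a => by
    simpa using (ENNReal.toReal_le_toReal (hfin a) ENNReal.one_ne_top).2 (hF1 a)
  have hf0 : ∀ a, 0 ≤ f a := fun a => ENNReal.toReal_nonneg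
  set m := ∫ a, f a ∂P with hm
  have hfi : Integrable f P := Integrable.of_bound hfm.aestronglyMeasurable 1
    (ae_of_all _ fun a => by rw [Real.norm_eq_abs, abs_of_nonneg (hf0 a)]; exact hf1 a)
  have hfi2 : Integrable (fun a => f a ^ 2) P :=
    Integrable.of_bound (hfm.pow_const 2).aestronglyMeasurable 1
    (ae_of_all _ fun a => by
      rw [Real.norm_eq_abs, abs_of_nonneg (by positivity)]
      exact pow_le_one₀ (hf0 a) (hf1 a))
  have hmF : m = (∫⁻ a, F a ∂P).toReal :=
    integral_toReal hF.aemeasurable (ae_of_all _ fun a => (hfin a).lt_top)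
  have hm2 : ∫ a, f a ^ 2 ∂P = m ^ 2 := by
    rw [hmF, ← ENNReal.toReal_pow, h, ← integral_toReal (hF.pow_const 2).aemeasurable
      (ae_of_all _ fun a => (ENNReal.pow_ne_top (hfin a)).lt_top)]
    simp [hf]
  have hvar : ∫ a, (f a - m) ^ 2 ∂P = 0 := by
    have : ∀ a, (f a - m) ^ 2 = f a ^ 2 - (2 * m) * f a + m ^ 2 := fun a => by ring
    simp_rw [this]
    have hfm2 : Integrable (fun a => 2 * m * f a) P := hfi.const_mul _
    have hsub : Integrable (fun a => f a ^ 2 - 2 * m * f a) P := hfi2.sub hfm2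
    rw [integral_add hsub (integrable_const _), integral_sub hfi2 hfm2, integral_const_mul, hm2,
      ← hm]
    simp
    ring
  have hi : Integrable (fun a => (f a - m) ^ 2) P := by
    have : ∀ a, (f a - m) ^ 2 = f a ^ 2 - (2 * m) * f a + m ^ 2 := fun a => by ring
    simp_rw [this]
    exact (hfi2.sub (hfi.const_mul _)).add (integrable_const _)
  filter_upwards [(integral_eq_zero_iff_of_nonneg (fun a => sq_nonneg _) hi).1 hvar] with a ha
  have hfa : f a = m := by
    have : (f a - m) ^ 2 = 0 := ha
    nlinarith
  have hlt : ∫⁻ b, F b ∂P ≠ ⊤ := by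
    refine ((lintegral_mono hF1).trans_lt ?_).ne
    simp
  rw [← ENNReal.toReal_eq_toReal_iff' (hfin a) hlt, ← hmF]
  exact hfa

lemma ae_window_invariant {P : Measure AffP} [IsProbabilityMeasure P] {σ : Measure ℝ}
    [IsProbabilityMeasure σ] (hs : Stationary P σ) {h : ℝ} (hh : 0 < h)
    (heq : energy σ h = ∫⁻ φ, energy σ (h / φ.1.1) ∂P) :
    ∀ᵐ φ ∂P, ∀ᵐ y, σ (act φ ⁻¹' Icc y (y + h)) = σ (Icc y (y + h)) := by
  have hG := measurable_window_act σ h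
  have hmeq : ∀ y, σ (Icc y (y + h)) = ∫⁻ φ, σ (act φ ⁻¹' Icc y (y + h)) ∂P :=
    fun y => hs.measure_eq measurableSet_Icc
  have hGy : ∀ y, Measurable fun φ => σ (act φ ⁻¹' Icc y (y + h)) := fun y =>
    hG.comp measurable_prodMk_right
  have hint : ∫⁻ y, ∫⁻ φ, σ (act φ ⁻¹' Icc y (y + h)) ^ 2 ∂P = ∫⁻ y, σ (Icc y (y + h)) ^ 2 := by
    rw [lintegral_lintegral_swap ((hG.comp measurable_swap).pow_const 2).aemeasurable,
      energy_mul_ofReal σ hh, heq, ← lintegral_const_mul' _ _ (by simp)]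
    exact lintegral_congr fun φ => lintegral_sq_window_act σ φ hh
  have hfin : ∫⁻ y, σ (Icc y (y + h)) ^ 2 ≠ ⊤ := by
    rw [energy_mul_ofReal σ hh]
    refine ENNReal.mul_ne_top (by simp) ((energy_le_sq σ hh).trans_lt ?_).ne
    simp
  have hle : (fun y => σ (Icc y (y + h)) ^ 2) ≤ᵐ[volume]
      fun y => ∫⁻ φ, σ (act φ ⁻¹' Icc y (y + h)) ^ 2 ∂P := ae_of_all _ fun y => by
    dsimp only
    rw [hmeq y]
    exact sq_lintegral_le P (hGy y)
  have hae := ae_eq_of_ae_le_of_lintegral_le hle hfin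
    ((hG.comp measurable_swap).pow_const 2).lintegral_prod_right'.aemeasurable hint.le
  have hms : MeasurableSet {z : AffP × ℝ | σ (act z.1 ⁻¹' Icc z.2 (z.2 + h)) =
      σ (Icc z.2 (z.2 + h))} :=
    measurableSet_eq_fun hG ((measurable_window σ h).comp measurable_snd)
  rw [Measure.ae_ae_comm hms]
  filter_upwards [hae] with y hy
  have := ae_eq_of_sq_lintegral_eq P (hGy y) (fun φ => prob_le_one) (by rw [← hmeq y]; exact hy)
  filter_upwards [this] with φ hφ
  rw [hφ, hmeq y]

lemma map_act_eq_of_windows {σ : Measure ℝ} [IsProbabilityMeasure σ] (φ : AffP) {h : ℕ → ℝ}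
    (hh : Tendsto h atTop atTop)
    (hw : ∀ n, ∀ᵐ y, σ (act φ ⁻¹' Icc y (y + h n)) = σ (Icc y (y + h n))) :
    σ.map (act φ) = σ := by
  have hm : Measurable (act φ) := by fun_prop
  have : IsProbabilityMeasure (σ.map (act φ)) := Measure.isProbabilityMeasure_map hm.aemeasurable
  have hlim : ∀ (μ : Measure ℝ) [IsProbabilityMeasure μ] (y : ℝ),
      Tendsto (fun n => μ (Icc y (y + h n))) atTop (𝓝 (μ (Ici y))) := by
    intro μ _ y
    have h1 : Tendsto (fun b => μ (Icc y b)) atTop (𝓝 (μ (Ici y))) := by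
      have := tendsto_measure_iUnion_atTop (μ := μ) (s := fun b : ℝ => Icc y b)
        (fun a b hab => Icc_subset_Icc_right hab)
      rwa [iUnion_Icc_right] at this
    exact h1.comp (tendsto_atTop_add_const_left _ _ hh)
  have hae : ∀ᵐ y, σ.map (act φ) (Ici y) = σ (Ici y) := by
    filter_upwards [ae_all_iff.2 hw] with y hy
    refine tendsto_nhds_unique (hlim (σ.map (act φ)) y) ?_
    simp_rw [Measure.map_apply hm measurableSet_Icc, hy]
    exact hlim σ y
  have hdense := Measure.dense_of_ae hae
  refine Measure.ext_of_Ici _ _ fun a => ?_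
  obtain ⟨u, hu, hlt, hua⟩ := hdense.exists_seq_strictMono_tendsto a
  have hcont : ∀ (μ : Measure ℝ) [IsProbabilityMeasure μ],
      Tendsto (fun n => μ (Ici (u n))) atTop (𝓝 (μ (Ici a))) := by
    intro μ _
    have := tendsto_measure_iInter_atTop (μ := μ) (s := fun n => Ici (u n))
      (fun n => measurableSet_Ici.nullMeasurableSet)
      (fun m n hmn => Ici_subset_Ici.2 (hu.monotone hmn)) ⟨0, measure_ne_top _ _⟩
    suffices heq : Ici a = ⋂ n, Ici (u n) by rwa [← heq] at this
    ext x
    simp only [mem_Ici, mem_iInter]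
    exact ⟨fun hx n => (hlt n).1.le.trans hx, fun hx => le_of_tendsto' hua hx⟩
  refine tendsto_nhds_unique (hcont (σ.map (act φ))) ?_
  have : ∀ n, σ.map (act φ) (Ici (u n)) = σ (Ici (u n)) := fun n => (hlt n).2
  simp_rw [this]
  exact hcont σ

lemma strictMono_act (φ : AffP) : StrictMono (act φ) := by
  intro x y hxy
  have := mul_lt_mul_of_pos_left hxy φ.2
  simp only [act]
  linarith

/-- A finite measure preserved by an increasing affine map is carried by its fixed points. -/
lemma ae_fixed_of_map_eq {σ : Measure ℝ} [IsProbabilityMeasure σ] {φ : AffP}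
    (h : σ.map (act φ) = σ) : ∀ᵐ x ∂σ, act φ x = x := by
  have hmp : MeasurePreserving (act φ) σ σ := ⟨by fun_prop, h⟩
  filter_upwards [hmp.conservative.ae_frequently_mem_of_mem_nhds] with x hx
  by_contra hne
  have hmono := (strictMono_act φ).monotone
  rcases lt_or_gt_of_ne hne with hlt | hgt
  · obtain ⟨n, hn, hn1⟩ := ((hx (Ioi (act φ x)) (Ioi_mem_nhds hlt)).and_eventually
      (eventually_ge_atTop 1)).exists
    have := (hmono.antitone_iterate_of_map_le hlt.le) hn1
    simp only [Function.iterate_one] at this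
    exact absurd hn (not_lt.2 this)
  · obtain ⟨n, hn, hn1⟩ := ((hx (Iio (act φ x)) (Iio_mem_nhds hgt)).and_eventually
      (eventually_ge_atTop 1)).exists
    have := (hmono.monotone_iterate_of_le_map hgt.le) hn1
    simp only [Function.iterate_one] at this
    exact absurd hn (not_lt.2 this)

lemma exists_common_fixed_point {P : Measure AffP} [IsProbabilityMeasure P] {σ : Measure ℝ}
    [IsProbabilityMeasure σ] (h : ∀ᵐ φ ∂P, σ.map (act φ) = σ) :
    ∃ x, ∀ φ ∈ msupport P, act φ x = x := by
  have hms : MeasurableSet {z : AffP × ℝ | act z.1 z.2 = z.2} :=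
    measurableSet_eq_fun (by fun_prop) measurable_snd
  have h1 : ∀ᵐ φ ∂P, ∀ᵐ x ∂σ, act φ x = x := by
    filter_upwards [h] with φ hφ using ae_fixed_of_map_eq hφ
  rw [Measure.ae_ae_comm hms] at h1
  obtain ⟨x, hx⟩ := h1.exists
  refine ⟨x, fun φ hφ => ?_⟩
  by_contra hne
  have hopen : IsOpen {ψ : AffP | act ψ x ≠ x} :=
    isOpen_ne_fun (continuous_act.comp (by fun_prop : Continuous fun ψ : AffP => (ψ, x)))
      continuous_const
  exact (hφ _ hopen hne).ne' hx

lemma drift_neg {P : Measure AffP} [IsProbabilityMeasure P] {σ : Measure ℝ}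
    [IsProbabilityMeasure σ] (hs : Stationary P σ)
    (hnofix : ¬ ∃ x, ∀ φ ∈ msupport P, act φ x = x)
    (hX : Integrable (fun φ : AffP => Real.log φ.1.1) P) :
    ∫ φ : AffP, Real.log φ.1.1 ∂P < 0 := by
  by_contra! hX0
  have hXm : Measurable fun φ : AffP => Real.log φ.1.1 := by fun_prop
  have hle1 : ∀ {h : ℝ}, 0 < h → energy σ h ≤ 1 := fun hh => by simpa using energy_le_sq σ hh
  have hfin : ∀ {h : ℝ}, 0 < h → energy σ h ≠ ⊤ := fun hh =>
    ((hle1 hh).trans_lt ENNReal.one_lt_top).ne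
  have hdiv : ∀ (s : ℝ) (φ : AffP), Real.exp (s - Real.log φ.1.1) = Real.exp s / φ.1.1 :=
    fun s φ => by rw [Real.exp_sub, Real.exp_log φ.2]
  set β : ℝ → ℝ := fun s => (energy σ (Real.exp s)).toReal with hβ
  have hmono : Monotone β := fun s t hst => by
    refine ENNReal.toReal_mono (hfin (Real.exp_pos t)) ?_
    exact energy_mono σ (Real.exp_pos s) (Real.exp_le_exp.2 hst)
  have hβi : ∀ s, ∫ φ : AffP, β (s - Real.log φ.1.1) ∂P =
      (∫⁻ φ : AffP, energy σ (Real.exp s / φ.1.1) ∂P).toReal := by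
    intro s
    have hpos : ∀ φ : AffP, 0 < Real.exp s / φ.1.1 := fun φ => div_pos (Real.exp_pos s) φ.2
    rw [← integral_toReal]
    · simp only [hβ, hdiv]
    · have : Measurable fun φ : AffP => ENNReal.ofReal (β (s - Real.log φ.1.1)) :=
        (hmono.measurable.comp (measurable_const.sub hXm)).ennreal_ofReal
      refine this.aemeasurable.congr (ae_of_all _ fun φ => ?_)
      simp only [hβ, hdiv]
      exact ENNReal.ofReal_toReal (hfin (hpos φ))
    · exact ae_of_all _ fun φ => (hfin (hpos φ)).lt_top
  have hintfin : ∀ s, ∫⁻ φ : AffP, energy σ (Real.exp s / φ.1.1) ∂P ≠ ⊤ := by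
    intro s
    refine ((lintegral_mono fun φ : AffP => hle1 (div_pos (Real.exp_pos s) φ.2)).trans_lt ?_).ne
    simp
  have hae := ae_harmonic_of_subharmonic P hXm hX hX0 hmono (fun s => ENNReal.toReal_nonneg)
    (fun s => by simpa using ENNReal.toReal_mono ENNReal.one_ne_top (hle1 (Real.exp_pos s)))
    (fun s => by
      rw [hβi]
      exact ENNReal.toReal_mono (hintfin s) (hs.energy_le (Real.exp_pos s)))
  have hdense := Measure.dense_of_ae hae
  have hex : ∀ n : ℕ, ∃ s, (n : ℝ) < s ∧ β s = ∫ φ : AffP, β (s - Real.log φ.1.1) ∂P := by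
    intro n
    obtain ⟨s, hs1, hs2⟩ := hdense.exists_between (lt_add_one (n : ℝ))
    exact ⟨s, hs2.1, hs1⟩
  choose s hsn hseq using hex
  have hw : ∀ n, ∀ᵐ φ ∂P, ∀ᵐ y, σ (act φ ⁻¹' Icc y (y + Real.exp (s n))) =
      σ (Icc y (y + Real.exp (s n))) := by
    intro n
    refine ae_window_invariant hs (Real.exp_pos _) ?_
    have := hseq n
    rw [hβi] at this
    exact (ENNReal.toReal_eq_toReal_iff' (hfin (Real.exp_pos _)) (hintfin _)).1 this
  have hst : Tendsto s atTop atTop :=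
    tendsto_atTop_mono (fun n => (hsn n).le) tendsto_natCast_atTop_atTop
  refine hnofix (exists_common_fixed_point (P := P) (σ := σ) ?_)
  filter_upwards [ae_all_iff.2 hw] with φ hφ
  exact map_act_eq_of_windows φ (Real.tendsto_exp_atTop.comp hst) hφ

/-! ### Moments -/

/-- The scale factor `max 1 r⁻ᶜ` of an affine map of slope `r`. -/
noncomputable def scaleFactor (c : ℝ) (φ : AffP) : ℝ≥0∞ :=
  ENNReal.ofReal (max 1 (φ.1.1 ^ (-c)))

/-- The power `rˢ` of the slope of an affine map. -/
noncomputable def slopePow (s : ℝ) (φ : AffP) : ℝ≥0∞ := ENNReal.ofReal (φ.1.1 ^ s)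

@[fun_prop]
lemma measurable_scaleFactor (c : ℝ) : Measurable (scaleFactor c) := by
  unfold scaleFactor; fun_prop

@[fun_prop]
lemma measurable_slopePow (s : ℝ) : Measurable (slopePow s) := by
  unfold slopePow; fun_prop

lemma one_le_scaleFactor (c : ℝ) (φ : AffP) : 1 ≤ scaleFactor c φ := by
  rw [scaleFactor, ← ENNReal.ofReal_one]
  exact ENNReal.ofReal_le_ofReal (le_max_left _ _)

lemma scaleFactor_mono {c c' : ℝ} (hc : 0 ≤ c) (h : c ≤ c') (φ : AffP) :
    scaleFactor c φ ≤ scaleFactor c' φ := by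
  have hr : 0 < φ.1.1 := φ.2
  refine ENNReal.ofReal_le_ofReal (max_le (le_max_left _ _) ?_)
  rcases le_total 1 φ.1.1 with h1 | h1
  · exact (Real.rpow_le_one_of_one_le_of_nonpos h1 (by linarith)).trans (le_max_left _ _)
  · exact (Real.rpow_le_rpow_of_exponent_ge hr h1 (by linarith)).trans (le_max_right _ _)

lemma scaleFactor_le (c : ℝ) (φ : AffP) : scaleFactor c φ ≤ 1 + slopePow (-c) φ := by
  have hr : 0 < φ.1.1 := φ.2
  rw [scaleFactor, slopePow, ← ENNReal.ofReal_one, ← ENNReal.ofReal_add zero_le_one (by positivity)]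
  have : 0 < φ.1.1 ^ (-c) := by positivity
  exact ENNReal.ofReal_le_ofReal (max_le (by linarith) (by linarith))

lemma slopePow_add (s t : ℝ) (φ : AffP) : slopePow (s + t) φ = slopePow s φ * slopePow t φ := by
  have hr : 0 < φ.1.1 := φ.2
  rw [slopePow, slopePow, slopePow, ← ENNReal.ofReal_mul (by positivity), Real.rpow_add hr]

lemma slopePow_zero (φ : AffP) : slopePow 0 φ = 1 := by simp [slopePow]

lemma slopePow_comp (s : ℝ) (φ ψ : AffP) :
    slopePow s (comp φ ψ) = slopePow s φ * slopePow s ψ := by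
  have hr : 0 < φ.1.1 := φ.2
  have hr' : 0 < ψ.1.1 := ψ.2
  rw [slopePow, slopePow, slopePow, ← ENNReal.ofReal_mul (by positivity),
    ← Real.mul_rpow hr.le hr'.le]
  rfl

lemma enorm_act_rpow_le {q : ℝ} (hq : 0 ≤ q) (hq1 : q ≤ 1) (φ : AffP) (x : ℝ) :
    ‖act φ x‖ₑ ^ q ≤ slopePow q φ * ‖x‖ₑ ^ q + ‖φ.1.2‖ₑ ^ q := by
  have hr : 0 < φ.1.1 := φ.2
  calc ‖act φ x‖ₑ ^ q ≤ (‖φ.1.1 * x‖ₑ + ‖φ.1.2‖ₑ) ^ q := by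
        gcongr; exact enorm_add_le _ _
    _ ≤ ‖φ.1.1 * x‖ₑ ^ q + ‖φ.1.2‖ₑ ^ q := ENNReal.rpow_add_le_add_rpow _ _ hq hq1
    _ = _ := by
        rw [enorm_mul, ENNReal.mul_rpow_of_nonneg _ _ hq, slopePow,
          Real.enorm_of_nonneg hr.le, ENNReal.ofReal_rpow_of_pos hr]

lemma lintegral_slopePow_convPow (P : Measure AffP) [IsProbabilityMeasure P] (s : ℝ) (n : ℕ) :
    ∫⁻ φ, slopePow s φ ∂(convPow P n) = (∫⁻ φ, slopePow s φ ∂P) ^ n := by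
  induction n with
  | zero => simp [convPow, slopePow, one]
  | succ n ih =>
    rw [convPow, lintegral_conv _ _ (by fun_prop)]
    simp_rw [slopePow_comp]
    simp_rw [lintegral_const_mul _ (measurable_slopePow s)]
    rw [ih, lintegral_mul_const _ (measurable_slopePow s), pow_succ, mul_comm]

lemma lintegral_translation_convPow_ne_top {P : Measure AffP} [IsProbabilityMeasure P] {s : ℝ}
    (hs : 0 < s) (hs1 : s ≤ 1) (hr : ∫⁻ φ, slopePow s φ ∂P ≠ ⊤)
    (hb : ∫⁻ φ : AffP, ‖φ.1.2‖ₑ ^ s ∂P ≠ ⊤) (n : ℕ) :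
    ∫⁻ φ : AffP, ‖φ.1.2‖ₑ ^ s ∂(convPow P n) ≠ ⊤ := by
  have hm : Measurable fun φ : AffP => ‖φ.1.2‖ₑ ^ s := by fun_prop
  induction n with
  | zero => simp [convPow, one, hs]
  | succ n ih =>
    rw [convPow, lintegral_conv _ _ hm]
    refine ne_top_of_le_ne_top ?_ (lintegral_mono fun φ => lintegral_mono fun ψ =>
      enorm_act_rpow_le hs.le hs1 φ ψ.1.2)
    simp_rw [lintegral_add_right _ measurable_const, lintegral_const_mul _ hm]
    rw [lintegral_add_left ((measurable_slopePow s).mul_const _),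
      lintegral_mul_const _ (measurable_slopePow s)]
    simp only [lintegral_const, measure_univ, mul_one]
    exact ENNReal.add_ne_top.2 ⟨ENNReal.mul_ne_top hr ih, hb⟩

lemma tendsto_lintegral_mul_scaleFactor (P : Measure AffP) {w : AffP → ℝ≥0∞} (hw : Measurable w)
    {c₀ : ℝ} (hc₀ : 0 < c₀) (hfin : ∫⁻ φ, w φ * scaleFactor c₀ φ ∂P ≠ ⊤) :
    Tendsto (fun c => ∫⁻ φ, w φ * scaleFactor c φ ∂P) (𝓝[>] 0) (𝓝 (∫⁻ φ, w φ ∂P)) := by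
  refine tendsto_lintegral_filter_of_dominated_convergence (fun φ => w φ * scaleFactor c₀ φ)
    (Eventually.of_forall fun c => by fun_prop) ?_ hfin (ae_of_all _ fun φ => ?_)
  · filter_upwards [Ioc_mem_nhdsGT hc₀] with c hc
    exact ae_of_all _ fun φ => by gcongr; exact scaleFactor_mono hc.1.le hc.2 φ
  · have hr : φ.1.1 ≠ 0 := φ.2.ne'
    have h1 : Tendsto (fun c => scaleFactor c φ) (𝓝 0) (𝓝 1) := by
      have : Continuous fun c => scaleFactor c φ := by
        unfold scaleFactor
        exact ENNReal.continuous_ofReal.comp (continuous_const.max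
          ((Real.continuous_const_rpow hr).comp continuous_neg))
      simpa [scaleFactor] using this.tendsto 0
    have h2 : Tendsto (fun c => scaleFactor c φ) (𝓝[>] 0) (𝓝 1) :=
      h1.mono_left nhdsWithin_le_nhds
    simpa using ENNReal.Tendsto.const_mul (a := w φ) h2 (Or.inl one_ne_zero)

lemma lintegral_scaleFactor_ne_top {P : Measure AffP} [IsProbabilityMeasure P] {c : ℝ}
    (h : ∫⁻ φ, slopePow (-c) φ ∂P ≠ ⊤) : ∫⁻ φ, scaleFactor c φ ∂P ≠ ⊤ := by
  refine ne_top_of_le_ne_top ?_ (lintegral_mono (scaleFactor_le c))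
  rw [lintegral_add_left measurable_const]
  simp [h]

lemma lintegral_slopePow_mul_scaleFactor_ne_top {P : Measure AffP} [IsProbabilityMeasure P] {s : ℝ}
    (h : ∫⁻ φ, slopePow s φ ∂P ≠ ⊤) : ∫⁻ φ, slopePow s φ * scaleFactor s φ ∂P ≠ ⊤ := by
  refine ne_top_of_le_ne_top ?_ (lintegral_mono fun φ =>
    mul_le_mul_right (scaleFactor_le s φ) (slopePow s φ))
  simp_rw [mul_add, mul_one, ← slopePow_add, add_neg_cancel, slopePow_zero]
  rw [lintegral_add_left (by fun_prop)]
  simp [h]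

lemma scaleFactor_sq (c : ℝ) (φ : AffP) : scaleFactor c φ ^ 2 = scaleFactor (2 * c) φ := by
  have hr : 0 < φ.1.1 := φ.2
  have h0 : (0 : ℝ) ≤ φ.1.1 ^ (-c) := by positivity
  have h2 : φ.1.1 ^ (-(2 * c)) = (φ.1.1 ^ (-c)) ^ 2 := by
    rw [← Real.rpow_natCast, ← Real.rpow_mul hr.le]; congr 1; push_cast; ring
  rw [scaleFactor, scaleFactor, ← ENNReal.ofReal_pow (by positivity), h2]
  congr 1
  rcases le_total 1 (φ.1.1 ^ (-c)) with h | h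
  · rw [max_eq_right h, max_eq_right (one_le_pow₀ h)]
  · rw [max_eq_left h, max_eq_left (pow_le_one₀ h0 h)]; norm_num

lemma lintegral_mul_scaleFactor_ne_top {P : Measure AffP} {c : ℝ}
    (h : ∫⁻ φ, scaleFactor (2 * c) φ ∂P ≠ ⊤) {w : AffP → ℝ≥0∞} (hw : Measurable w)
    (hw2 : ∫⁻ φ, w φ ^ 2 ∂P ≠ ⊤) : ∫⁻ φ, w φ * scaleFactor c φ ∂P ≠ ⊤ := by
  refine ne_top_of_le_ne_top ?_ (lintegral_mono (g := fun φ => w φ ^ 2 + scaleFactor (2 * c) φ)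
    fun φ => ?_)
  · rw [lintegral_add_left (hw.pow_const 2)]
    exact ENNReal.add_ne_top.2 ⟨hw2, h⟩
  · dsimp only
    rw [← scaleFactor_sq]
    refine le_trans ?_ (two_mul_le_sq _ _)
    exact le_mul_of_one_le_left' one_le_two

/-- A stationary measure of a contracting-on-average affine walk has a finite moment. -/
lemma Stationary.moment_ne_top {P : Measure AffP} [IsProbabilityMeasure P] {σ : Measure ℝ}
    [IsProbabilityMeasure σ] (hs : Stationary P σ) {q : ℝ} (hq : 0 < q) (hq1 : q ≤ 1)
    (hA : ∫⁻ φ, slopePow q φ ∂P < 1) (hB : ∫⁻ φ : AffP, ‖φ.1.2‖ₑ ^ q ∂P ≠ ⊤) :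
    ∫⁻ x, ‖x‖ₑ ^ q ∂σ ≠ ⊤ := by
  set A := ∫⁻ φ, slopePow q φ ∂P with hAdef
  set B := ∫⁻ φ : AffP, ‖φ.1.2‖ₑ ^ q ∂P with hBdef
  set C := (1 - A)⁻¹ * B with hC
  have hCtop : C ≠ ⊤ := ENNReal.mul_ne_top (ENNReal.inv_ne_top.2 (tsub_pos_of_lt hA).ne') hB
  have hSC : ∀ n : ℕ, (∑ i ∈ Finset.range n, A ^ i) * B ≤ C := fun n => by
    rw [hC, ← ENNReal.tsum_geometric]
    gcongr
    exact ENNReal.sum_le_tsum _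
  have hbm : Measurable fun φ : AffP => ‖φ.1.2‖ₑ ^ q := by fun_prop
  have hstep : ∀ (L : ℝ≥0∞) (a S : ℝ≥0∞), ∫⁻ x, min L (a * ‖x‖ₑ ^ q + S) ∂σ ≤
      ∫⁻ x, min L (a * A * ‖x‖ₑ ^ q + (S + a * B)) ∂σ := by
    intro L a S
    rw [hs _ (by fun_prop), lintegral_lintegral_swap (by fun_prop)]
    refine lintegral_mono fun x => le_min ?_ ?_
    · refine (lintegral_mono fun φ => min_le_left _ _).trans ?_
      simp
    · calc ∫⁻ φ, min L (a * ‖act φ x‖ₑ ^ q + S) ∂P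
          ≤ ∫⁻ φ : AffP, (a * (slopePow q φ * ‖x‖ₑ ^ q + ‖φ.1.2‖ₑ ^ q) + S) ∂P := by
            refine lintegral_mono fun φ => (min_le_right _ _).trans ?_
            gcongr
            exact enorm_act_rpow_le hq.le hq1 φ x
        _ = _ := by
            rw [lintegral_add_right _ measurable_const, lintegral_const_mul _ (by fun_prop),
              lintegral_add_right _ hbm, lintegral_mul_const _ (by fun_prop)]
            simp only [lintegral_const, measure_univ, mul_one]
            ring
  have hiter : ∀ (L : ℝ≥0∞) (n : ℕ), ∫⁻ x, min L (‖x‖ₑ ^ q) ∂σ ≤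
      ∫⁻ x, min L (A ^ n * ‖x‖ₑ ^ q + (∑ i ∈ Finset.range n, A ^ i) * B) ∂σ := by
    intro L n
    induction n with
    | zero => simp
    | succ n ih =>
      refine (ih.trans (hstep L _ _)).trans (le_of_eq ?_)
      rw [Finset.sum_range_succ, add_mul, pow_succ]
  have hbound : ∀ L : ℕ, ∫⁻ x, min (L : ℝ≥0∞) (‖x‖ₑ ^ q) ∂σ ≤ C := by
    intro L
    have hlim : Tendsto (fun n : ℕ => ∫⁻ x, min (L : ℝ≥0∞) (A ^ n * ‖x‖ₑ ^ q + C) ∂σ) atTop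
        (𝓝 (∫⁻ x, min (L : ℝ≥0∞) (0 * ‖x‖ₑ ^ q + C) ∂σ)) := by
      refine tendsto_lintegral_of_dominated_convergence (fun _ => (L : ℝ≥0∞))
        (fun n => by fun_prop) (fun n => ae_of_all _ fun x => min_le_left _ _) (by simp)
        (ae_of_all _ fun x => ?_)
      refine tendsto_const_nhds.min (Tendsto.add_const _ ?_)
      refine ENNReal.Tendsto.mul_const (ENNReal.tendsto_pow_atTop_nhds_zero_of_lt_one hA)
        (Or.inr ?_)
      exact ENNReal.rpow_ne_top_of_nonneg hq.le (by simp)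
    have := ge_of_tendsto' hlim fun n => (hiter L n).trans (lintegral_mono fun x => by
      gcongr; exact hSC n)
    refine this.trans ?_
    simp
  have hmono : Tendsto (fun L : ℕ => ∫⁻ x, min (L : ℝ≥0∞) (‖x‖ₑ ^ q) ∂σ) atTop
      (𝓝 (∫⁻ x, ‖x‖ₑ ^ q ∂σ)) := by
    refine lintegral_tendsto_of_tendsto_of_monotone (fun n => by fun_prop)
      (ae_of_all _ fun x m n hmn => by dsimp only; gcongr) (ae_of_all _ fun x => ?_)
    have := (ENNReal.tendsto_nat_nhds_top.min (tendsto_const_nhds (x := ‖x‖ₑ ^ q)))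
    simpa using this
  exact ne_top_of_le_ne_top hCtop (le_of_tendsto' hmono hbound)

lemma rpow_le_rpow_add_rpow_neg {r s ε : ℝ} (hr : 0 < r) (hs : |s| ≤ ε) :
    r ^ s ≤ r ^ ε + r ^ (-ε) := by
  obtain ⟨h1, h2⟩ := abs_le.1 hs
  have p1 : 0 < r ^ ε := by positivity
  have p2 : 0 < r ^ (-ε) := by positivity
  rcases le_total 1 r with h | h
  · linarith [Real.rpow_le_rpow_of_exponent_le h h2]
  · linarith [Real.rpow_le_rpow_of_exponent_ge hr h h1]

lemma lintegral_slopePow_ne_top {P : Measure AffP} {ε s : ℝ}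
    (hmom : ∫⁻ φ : AffP, ENNReal.ofReal (φ.1.1 ^ ε + φ.1.1 ^ (-ε) + |φ.1.2| ^ ε) ∂P < ⊤)
    (hs : |s| ≤ ε) : ∫⁻ φ, slopePow s φ ∂P ≠ ⊤ := by
  refine ne_top_of_le_ne_top hmom.ne (lintegral_mono fun φ => ENNReal.ofReal_le_ofReal ?_)
  have := rpow_le_rpow_add_rpow_neg φ.2 hs
  have : 0 ≤ |φ.1.2| ^ ε := by positivity
  linarith

lemma lintegral_translation_ne_top {P : Measure AffP} [IsProbabilityMeasure P] {ε s : ℝ}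
    (hmom : ∫⁻ φ : AffP, ENNReal.ofReal (φ.1.1 ^ ε + φ.1.1 ^ (-ε) + |φ.1.2| ^ ε) ∂P < ⊤)
    (hs0 : 0 ≤ s) (hs : s ≤ ε) : ∫⁻ φ : AffP, ‖φ.1.2‖ₑ ^ s ∂P ≠ ⊤ := by
  have key : ∀ φ : AffP, ‖φ.1.2‖ₑ ^ s ≤
      1 + ENNReal.ofReal (φ.1.1 ^ ε + φ.1.1 ^ (-ε) + |φ.1.2| ^ ε) := fun φ => by
    have hr : 0 < φ.1.1 := φ.2
    have p1 : 0 < φ.1.1 ^ ε := by positivity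
    have p2 : 0 < φ.1.1 ^ (-ε) := by positivity
    have p3 : 0 ≤ |φ.1.2| ^ ε := by positivity
    rw [← ofReal_norm, Real.norm_eq_abs,
      ENNReal.ofReal_rpow_of_nonneg (abs_nonneg _) hs0, ← ENNReal.ofReal_one,
      ← ENNReal.ofReal_add zero_le_one (by positivity)]
    refine ENNReal.ofReal_le_ofReal ?_
    rcases le_total 1 |φ.1.2| with h | h
    · linarith [Real.rpow_le_rpow_of_exponent_le h hs]
    · linarith [Real.rpow_le_one (abs_nonneg _) h hs0]
  refine ne_top_of_le_ne_top ?_ (lintegral_mono key)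
  rw [lintegral_add_left measurable_const]
  simp [hmom.ne]

lemma integrable_exp_mul_log {P : Measure AffP} {ε s : ℝ}
    (hmom : ∫⁻ φ : AffP, ENNReal.ofReal (φ.1.1 ^ ε + φ.1.1 ^ (-ε) + |φ.1.2| ^ ε) ∂P < ⊤)
    (hs : |s| ≤ ε) : Integrable (fun φ : AffP => Real.exp (s * Real.log φ.1.1)) P := by
  refine ⟨Measurable.aestronglyMeasurable (by fun_prop), ?_⟩
  rw [hasFiniteIntegral_iff_ofReal (ae_of_all _ fun φ => (Real.exp_pos _).le)]
  convert (lintegral_slopePow_ne_top hmom hs).lt_top using 2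
  ext φ
  rw [slopePow, Real.rpow_def_of_pos φ.2, mul_comm]

lemma lintegral_slopePow_eq_mgf {P : Measure AffP} {ε s : ℝ}
    (hmom : ∫⁻ φ : AffP, ENNReal.ofReal (φ.1.1 ^ ε + φ.1.1 ^ (-ε) + |φ.1.2| ^ ε) ∂P < ⊤)
    (hs : |s| ≤ ε) : ∫⁻ φ, slopePow s φ ∂P =
      ENNReal.ofReal (ProbabilityTheory.mgf (fun φ : AffP => Real.log φ.1.1) P s) := by
  rw [ProbabilityTheory.mgf, ofReal_integral_eq_lintegral_ofReal (integrable_exp_mul_log hmom hs)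
    (ae_of_all _ fun φ => (Real.exp_pos _).le)]
  congr with φ
  rw [slopePow, Real.rpow_def_of_pos φ.2, mul_comm]

lemma zero_mem_interior_integrableExpSet {P : Measure AffP} {ε : ℝ} (hε : 0 < ε)
    (hmom : ∫⁻ φ : AffP, ENNReal.ofReal (φ.1.1 ^ ε + φ.1.1 ^ (-ε) + |φ.1.2| ^ ε) ∂P < ⊤) :
    0 ∈ interior (ProbabilityTheory.integrableExpSet (fun φ : AffP => Real.log φ.1.1) P) := by
  refine mem_interior.2 ⟨Ioo (-ε) ε, fun s hs => integrable_exp_mul_log hmom ?_, isOpen_Ioo,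
    by simp [hε]⟩
  exact abs_le.2 ⟨hs.1.le, hs.2.le⟩

lemma integrable_log_slope {P : Measure AffP} {ε : ℝ} (hε : 0 < ε)
    (hmom : ∫⁻ φ : AffP, ENNReal.ofReal (φ.1.1 ^ ε + φ.1.1 ^ (-ε) + |φ.1.2| ^ ε) ∂P < ⊤) :
    Integrable (fun φ : AffP => Real.log φ.1.1) P :=
  ProbabilityTheory.integrable_of_mem_interior_integrableExpSet
    (zero_mem_interior_integrableExpSet hε hmom)

/-- Negative drift and an exponential moment give a contracting exponent. -/
lemma exists_contracting_exponent {P : Measure AffP} [IsProbabilityMeasure P] {ε : ℝ} (hε : 0 < ε)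
    (hmom : ∫⁻ φ : AffP, ENNReal.ofReal (φ.1.1 ^ ε + φ.1.1 ^ (-ε) + |φ.1.2| ^ ε) ∂P < ⊤)
    (hdrift : ∫ φ : AffP, Real.log φ.1.1 ∂P < 0) {b : ℝ} (hb : 0 < b) (hbε : b ≤ ε) :
    ∃ p, 0 < p ∧ p ≤ b ∧ ∫⁻ φ, slopePow p φ ∂P < 1 := by
  have hd := ProbabilityTheory.hasDerivAt_mgf (zero_mem_interior_integrableExpSet hε hmom)
  simp only [zero_mul, Real.exp_zero, mul_one] at hd
  have hev := (hasDerivAt_iff_tendsto_slope.1 hd).eventually (Iio_mem_nhds hdrift)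
  have hev' := (hev.filter_mono (nhdsWithin_mono (t := {0}ᶜ) (s := Ioi 0) 0 fun x hx => hx.ne')).and
    (Ioc_mem_nhdsGT hb)
  obtain ⟨p, hp, hp0, hpb⟩ := hev'.exists
  refine ⟨p, hp0, hpb, ?_⟩
  rw [lintegral_slopePow_eq_mgf hmom (by rw [abs_of_pos hp0]; linarith), ENNReal.ofReal_lt_one]
  have := slope_def_field (ProbabilityTheory.mgf (fun φ : AffP => Real.log φ.1.1) P) 0 p
  rw [this, ProbabilityTheory.mgf_zero, sub_zero, div_neg_iff] at hp
  rcases hp with h | h <;> linarith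

lemma exists_contracting_of_drift {P : Measure AffP} [IsProbabilityMeasure P]
    (hdrift : ∫ φ : AffP, Real.log φ.1.1 ∂P < 0) : ∃ φ ∈ msupport P, φ.1.1 < 1 := by
  by_contra! h
  have hsupp : msupport P = P.support := by
    ext x
    simp only [msupport, mem_ofPred_eq, Measure.mem_support_iff_forall]
    exact ⟨fun hx U hU => (hx _ isOpen_interior (mem_interior_iff_mem_nhds.2 hU)).trans_le
      (measure_mono interior_subset), fun hx U hU hxU => hx U (hU.mem_nhds hxU)⟩
  have hae : ∀ᵐ φ ∂P, φ ∈ P.support := Measure.support_mem_ae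
  refine hdrift.not_ge (integral_nonneg_of_ae ?_)
  filter_upwards [hae] with φ hφ
  exact Real.log_nonneg (h φ (hsupp ▸ hφ))

lemma exists_least_const {u g : ℝ → ℝ≥0∞} (hg0 : ∀ h > 0, g h ≠ 0) (hg : ∀ h > 0, g h ≠ ⊤)
    {K : ℝ≥0∞} (hK : K ≠ ⊤) (hu : ∀ h > 0, u h ≤ K * g h) :
    ∃ N ≠ ⊤, (∀ h > 0, u h ≤ N * g h) ∧ ∀ N', (∀ h > 0, u h ≤ N' * g h) → N ≤ N' := by
  have hN : ∀ N', (∀ h > 0, u h ≤ N' * g h) → ⨆ (h : ℝ) (_ : 0 < h), u h / g h ≤ N' :=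
    fun N' h' => iSup₂_le fun h hh => ENNReal.div_le_of_le_mul (h' h hh)
  refine ⟨_, ne_top_of_le_ne_top hK (hN K hu), fun h hh => ?_, hN⟩
  rw [← ENNReal.div_le_iff (hg0 h hh) (hg h hh)]
  exact le_iSup₂ (f := fun (h : ℝ) (_ : 0 < h) => u h / g h) h hh

/-! ### Tightness of the energy -/

/-- The comparison function `(h + h₀)ᶜ` for energies. -/
noncomputable def gauge (c h₀ h : ℝ) : ℝ≥0∞ := ENNReal.ofReal ((h + h₀) ^ c)

lemma gauge_ne_zero {c h₀ h : ℝ} (h₀pos : 0 < h₀) (hh : 0 < h) : gauge c h₀ h ≠ 0 := by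
  simp only [gauge, ne_eq, ENNReal.ofReal_eq_zero, not_le]
  positivity

lemma gauge_ne_top (c h₀ h : ℝ) : gauge c h₀ h ≠ ⊤ := ENNReal.ofReal_ne_top

lemma gauge_mono {c h₀ h h' : ℝ} (hc : 0 ≤ c) (h₀pos : 0 < h₀) (hh : 0 ≤ h) (hle : h ≤ h') :
    gauge c h₀ h ≤ gauge c h₀ h' :=
  ENNReal.ofReal_le_ofReal (Real.rpow_le_rpow (by positivity) (by linarith) hc)

lemma gauge_div_le {c h₀ h : ℝ} (hc : 0 ≤ c) (h₀pos : 0 < h₀) (hh : 0 < h) (φ : AffP) :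
    gauge c h₀ (h / φ.1.1) ≤ scaleFactor c φ * gauge c h₀ h := by
  have hr : 0 < φ.1.1 := φ.2
  rw [gauge, gauge, scaleFactor, ← ENNReal.ofReal_mul (by positivity)]
  refine ENNReal.ofReal_le_ofReal ?_
  have hpos : 0 < (h + h₀) ^ c := by positivity
  rcases le_total 1 φ.1.1 with h1 | h1
  · have : (h / φ.1.1 + h₀) ^ c ≤ (h + h₀) ^ c :=
      Real.rpow_le_rpow (by positivity) (by gcongr; exact div_le_self hh.le h1) hc
    nlinarith [le_max_left 1 (φ.1.1 ^ (-c))]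
  · have : (h / φ.1.1 + h₀) ^ c ≤ φ.1.1 ^ (-c) * (h + h₀) ^ c := by
      rw [Real.rpow_neg hr.le, ← Real.inv_rpow hr.le, ← Real.mul_rpow (by positivity)
        (by positivity)]
      refine Real.rpow_le_rpow (by positivity) ?_ hc
      rw [inv_mul_eq_div, add_div]
      gcongr
      exact le_div_self h₀pos.le hr h1
    exact this.trans (by gcongr; exact le_max_right _ _)

/-- The measure with density `|x| ^ q` with respect to `σ`. -/
noncomputable def weighted (q : ℝ) (σ : Measure ℝ) : Measure ℝ :=
  σ.withDensity fun x => ‖x‖ₑ ^ q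

lemma Stationary.weighted_window_le {P : Measure AffP} {σ : Measure ℝ} [SFinite σ]
    (hs : Stationary P σ) {q : ℝ} (hq : 0 ≤ q) (hq1 : q ≤ 1) {A : Set ℝ} (hA : MeasurableSet A) :
    weighted q σ A ≤ ∫⁻ φ, (slopePow q φ * weighted q σ (act φ ⁻¹' A) +
      ‖φ.1.2‖ₑ ^ q * σ (act φ ⁻¹' A)) ∂P := by
  rw [weighted, withDensity_apply _ hA, ← lintegral_indicator hA,
    hs _ (Measurable.indicator (by fun_prop) hA)]
  refine lintegral_mono fun φ => ?_
  have hφ : MeasurableSet (act φ ⁻¹' A) := (by fun_prop : Measurable (act φ)) hA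
  rw [withDensity_apply _ hφ, ← lintegral_const_mul _ (by fun_prop), ← setLIntegral_const,
    ← lintegral_add_left (by fun_prop), ← lintegral_indicator hφ]
  refine lintegral_mono fun x => ?_
  by_cases hx : act φ x ∈ A
  · have hx' : x ∈ act φ ⁻¹' A := hx
    simp only [indicator_of_mem hx, indicator_of_mem hx']
    exact enorm_act_rpow_le hq hq1 φ x
  · simp [indicator_of_notMem hx]

lemma Stationary.energy_weighted_le {P : Measure AffP} [IsProbabilityMeasure P] {σ : Measure ℝ}
    [SFinite σ] (hs : Stationary P σ) {q : ℝ} (hq : 0 ≤ q) (hq1 : q ≤ 1)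
    [SFinite (weighted q σ)] {h : ℝ} (hh : 0 < h) :
    energy (weighted q σ) h ≤ ∫⁻ φ : AffP, (2 * (slopePow q φ ^ 2 *
      energy (weighted q σ) (h / φ.1.1)) + 2 * ((‖φ.1.2‖ₑ ^ q) ^ 2 * energy σ (h / φ.1.1))) ∂P := by
  have hm1 := measurable_window_act (weighted q σ) h
  have hm2 := measurable_window_act σ h
  refine energy_le_of_window_le (G := fun φ y => slopePow q φ *
    weighted q σ (act φ ⁻¹' Icc y (y + h)) + ‖φ.1.2‖ₑ ^ q * σ (act φ ⁻¹' Icc y (y + h)))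
    ?_ (fun y => hs.weighted_window_le hq hq1 measurableSet_Icc) fun φ => ?_
  · refine Measurable.add (Measurable.mul ?_ hm1) (Measurable.mul ?_ hm2)
    · exact (measurable_slopePow q).comp measurable_fst
    · fun_prop
  · have hφ1 := measurable_window_act_right (weighted q σ) φ h
    have hφ2 := measurable_window_act_right σ φ h
    have hcm : ∀ (a : ℝ≥0∞) {X : ℝ → ℝ≥0∞}, Measurable X →
        ∫⁻ y, 2 * (a * X y) = 2 * (a * ∫⁻ y, X y) := fun a X hX => by
      rw [lintegral_const_mul _ (hX.const_mul a), lintegral_const_mul _ hX]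
    refine (lintegral_mono fun y => add_sq_le_two _ _).trans (le_of_eq ?_)
    simp_rw [mul_pow]
    rw [lintegral_add_left (((hφ1.pow_const 2).const_mul _).const_mul _),
      hcm _ (hφ1.pow_const 2), hcm _ (hφ2.pow_const 2), lintegral_sq_window_act _ φ hh,
      lintegral_sq_window_act _ φ hh]
    ring

/-- A power bound for the energy of a stationary measure passes to its weighted version. -/
lemma Stationary.energy_weighted_le_gauge {P : Measure AffP} [IsProbabilityMeasure P]
    {σ : Measure ℝ} [SFinite σ] (hs : Stationary P σ) {q : ℝ} (hq : 0 ≤ q) (hq1 : q ≤ 1)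
    [IsFiniteMeasure (weighted q σ)] {c h₀ : ℝ} (hc : 0 ≤ c) (h₀pos : 0 < h₀)
    (hA : ∫⁻ φ, slopePow q φ ^ 2 * scaleFactor c φ ∂P ≤ 1 / 4) {B N : ℝ≥0∞}
    (hB : ∫⁻ φ : AffP, (‖φ.1.2‖ₑ ^ q) ^ 2 * scaleFactor c φ ∂P ≤ B)
    (hN : ∀ h > 0, energy σ h ≤ N * gauge c h₀ h) :
    ∀ h > 0, energy (weighted q σ) h ≤ 4 * B * N * gauge c h₀ h := by
  have hg0 : gauge c h₀ 0 ≠ 0 := by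
    simp only [gauge, ne_eq, ENNReal.ofReal_eq_zero, not_le]; positivity
  obtain ⟨L, hL, hLle, hLmin⟩ := exists_least_const (u := energy (weighted q σ))
    (g := gauge c h₀) (fun h hh => gauge_ne_zero h₀pos hh) (fun h _ => gauge_ne_top c h₀ h)
    (K := weighted q σ univ ^ 2 / gauge c h₀ 0)
    (ENNReal.div_ne_top (by simp) hg0) (fun h hh => by
      refine (energy_le_sq _ hh).trans ?_
      calc weighted q σ univ ^ 2 = weighted q σ univ ^ 2 / gauge c h₀ 0 * gauge c h₀ 0 :=
            (ENNReal.div_mul_cancel hg0 (gauge_ne_top _ _ _)).symm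
        _ ≤ _ := by gcongr; exact gauge_mono hc h₀pos le_rfl hh.le)
  have key : L ≤ 1 / 2 * L + 2 * B * N := by
    refine hLmin _ fun h hh => (hs.energy_weighted_le hq hq1 hh).trans ?_
    calc _ ≤ ∫⁻ φ : AffP, (slopePow q φ ^ 2 * scaleFactor c φ * (2 * L * gauge c h₀ h) +
          (‖φ.1.2‖ₑ ^ q) ^ 2 * scaleFactor c φ * (2 * N * gauge c h₀ h)) ∂P := by
          refine lintegral_mono fun φ => ?_
          have hpos : 0 < h / φ.1.1 := div_pos hh φ.2
          have hg := gauge_div_le hc h₀pos hh φ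
          calc _ ≤ 2 * (slopePow q φ ^ 2 * (L * (scaleFactor c φ * gauge c h₀ h))) +
                2 * ((‖φ.1.2‖ₑ ^ q) ^ 2 * (N * (scaleFactor c φ * gauge c h₀ h))) := by
                gcongr
                · exact (hLle _ hpos).trans (by gcongr)
                · exact (hN _ hpos).trans (by gcongr)
            _ = _ := by ring
      _ ≤ 1 / 4 * (2 * L * gauge c h₀ h) + B * (2 * N * gauge c h₀ h) := by
          rw [lintegral_add_left (by fun_prop), lintegral_mul_const _ (by fun_prop),
            lintegral_mul_const _ (by fun_prop)]
          gcongr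
      _ = _ := by
          have : (1 / 4 : ℝ≥0∞) * 2 = 1 / 2 := by
            rw [show (4 : ℝ≥0∞) = 2 * 2 by norm_num, one_div, one_div,
              ENNReal.mul_inv (by simp) (by simp), mul_assoc,
              ENNReal.inv_mul_cancel (by simp) (by simp), mul_one]
          rw [← mul_assoc, ← mul_assoc, this]
          ring
  intro h hh
  refine (hLle h hh).trans ?_
  gcongr
  have h2 : L = 1 / 2 * L + 1 / 2 * L := by
    rw [← add_mul, ENNReal.add_halves, one_mul]
  have h3 : 1 / 2 * L ≤ 2 * B * N := by
    nth_rw 1 [h2] at key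
    exact (ENNReal.add_le_add_iff_left (ENNReal.mul_ne_top (by simp) hL)).1 key
  rw [h2]
  calc _ ≤ 2 * B * N + 2 * B * N := add_le_add h3 h3
    _ = _ := by ring

/-! ### The energy gain from separated images -/

/-- A weight which gains a factor `1 / 2` on a set of pairs of affine maps. -/
noncomputable def gainWeight (U : Set (AffP × AffP)) (z : AffP × AffP) : ℝ≥0∞ :=
  Uᶜ.indicator 1 z + U.indicator (fun _ => 1 / 2) z

lemma measurable_gainWeight {U : Set (AffP × AffP)} (hU : MeasurableSet U) :
    Measurable (gainWeight U) :=
  (measurable_one.indicator hU.compl).add (measurable_const.indicator hU)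

lemma two_mul_window_le_gain {κ a b a' b' : ℝ≥0∞} (ha : a ≤ κ * a' ∨ b ≤ κ * b') :
    2 * (a * b) ≤ 1 / 4 * (a ^ 2 + b ^ 2) + 4 * κ ^ 2 * (a' ^ 2 + b' ^ 2) := by
  have h4 : (1 / 4 : ℝ≥0∞) ≠ 0 := by simp
  have h4' : (1 / 4 : ℝ≥0∞) ≠ ⊤ := by simp
  have h4i : (1 / 4 : ℝ≥0∞)⁻¹ = 4 := by simp
  rcases ha with h | h
  · calc 2 * (a * b) ≤ 2 * (b * (κ * a')) := by rw [mul_comm a b]; gcongr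
      _ ≤ 1 / 4 * b ^ 2 + (1 / 4)⁻¹ * (κ * a') ^ 2 := mul_le_weighted_sq _ _ _ h4 h4'
      _ = 1 / 4 * (0 + b ^ 2) + 4 * κ ^ 2 * (a' ^ 2 + 0) := by rw [h4i]; ring
      _ ≤ _ := by gcongr <;> exact zero_le
  · calc 2 * (a * b) ≤ 2 * (a * (κ * b')) := by gcongr
      _ ≤ 1 / 4 * a ^ 2 + (1 / 4)⁻¹ * (κ * b') ^ 2 := mul_le_weighted_sq _ _ _ h4 h4'
      _ = 1 / 4 * (a ^ 2 + 0) + 4 * κ ^ 2 * (0 + b' ^ 2) := by rw [h4i]; ring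
      _ ≤ _ := by gcongr <;> exact zero_le

lemma lintegral_gainWeight_add_le (Q : Measure AffP) [IsProbabilityMeasure Q] {M : AffP → ℝ≥0∞}
    (hM : Measurable M) (hM1 : ∀ φ, 1 ≤ M φ) {U₁ U₂ : Set AffP} (hU₁ : MeasurableSet U₁)
    (hU₂ : MeasurableSet U₂) :
    ∫⁻ z, gainWeight (U₁ ×ˢ U₂) z * (M z.1 + M z.2) ∂(Q.prod Q) + Q U₁ * Q U₂ ≤
      2 * ∫⁻ φ, M φ ∂Q := by
  have hU := hU₁.prod hU₂
  have h1 : ∫⁻ z : AffP × AffP, (M z.1 + M z.2) ∂(Q.prod Q) = 2 * ∫⁻ φ, M φ ∂Q := by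
    have hf : Measurable fun z : AffP × AffP => M z.1 := hM.comp measurable_fst
    rw [lintegral_add_left hf, lintegral_prod _ (by fun_prop), lintegral_prod _ (by fun_prop)]
    simp [two_mul]
  rw [← h1, ← Measure.prod_prod, ← lintegral_indicator_one hU, ← lintegral_add_right]
  swap
  · exact measurable_one.indicator hU
  refine lintegral_mono fun z => ?_
  by_cases hz : z ∈ U₁ ×ˢ U₂
  · have h2 : 1 ≤ 1 / 2 * (M z.1 + M z.2) := by
      calc (1 : ℝ≥0∞) = 1 / 2 * (1 + 1) := by
            rw [one_add_one_eq_two, ENNReal.div_mul_cancel (by simp) (by simp)]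
        _ ≤ _ := by gcongr <;> exact hM1 _
    have hz' : z ∉ (U₁ ×ˢ U₂)ᶜ := fun h => h hz
    simp only [gainWeight, indicator_of_mem hz, indicator_of_notMem hz', zero_add, Pi.one_apply]
    calc _ ≤ 1 / 2 * (M z.1 + M z.2) + 1 / 2 * (M z.1 + M z.2) := by gcongr
      _ = _ := by rw [← add_mul, ENNReal.add_halves, one_mul]
  · have hz' : z ∈ (U₁ ×ˢ U₂)ᶜ := hz
    simp [gainWeight, indicator_of_mem hz', indicator_of_notMem hz]

/-- If windows pulled back by pairs from `U₁ × U₂` are never both central, the energy gains. -/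
lemma Stationary.energy_gain {Q : Measure AffP} [IsProbabilityMeasure Q] {σ ν : Measure ℝ}
    [SFinite σ] [SFinite ν] (hs : Stationary Q σ) {c h₀ : ℝ} (hc : 0 ≤ c) (h₀pos : 0 < h₀)
    {U₁ U₂ : Set AffP} (hU₁ : MeasurableSet U₁) (hU₂ : MeasurableSet U₂) {N κ : ℝ≥0∞} {h : ℝ}
    (hh : 0 < h)
    (hsep : ∀ φ ∈ U₁, ∀ ψ ∈ U₂, ∀ y,
      σ (act φ ⁻¹' Icc y (y + h)) ≤ κ * ν (act φ ⁻¹' Icc y (y + h)) ∨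
      σ (act ψ ⁻¹' Icc y (y + h)) ≤ κ * ν (act ψ ⁻¹' Icc y (y + h)))
    (hN : ∀ k > 0, energy σ k ≤ N * gauge c h₀ k)
    (hν : ∀ k > 0, 4 * κ ^ 2 * energy ν k ≤ 1 / 4 * (N * gauge c h₀ k)) :
    2 * energy σ h ≤ (∫⁻ z, gainWeight (U₁ ×ˢ U₂) z * (scaleFactor c z.1 + scaleFactor c z.2)
      ∂(Q.prod Q)) * (N * gauge c h₀ h) := by
  set F : AffP → ℝ → ℝ≥0∞ := fun φ y => σ (act φ ⁻¹' Icc y (y + h)) with hF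
  have hFm : Measurable fun z : AffP × ℝ => F z.1 z.2 := measurable_window_act σ h
  have hFy : ∀ y, Measurable fun φ => F φ y := fun y =>
    hFm.comp (measurable_prodMk_right : Measurable fun φ : AffP => (φ, y))
  have hσ : ∀ φ : AffP, energy σ (h / φ.1.1) ≤ N * (scaleFactor c φ * gauge c h₀ h) := fun φ =>
    (hN _ (div_pos hh φ.2)).trans (by gcongr; exact gauge_div_le hc h₀pos hh φ)
  have hνφ : ∀ φ : AffP, 4 * κ ^ 2 * energy ν (h / φ.1.1) ≤
      1 / 4 * (N * (scaleFactor c φ * gauge c h₀ h)) := fun φ =>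
    (hν _ (div_pos hh φ.2)).trans (by gcongr; exact gauge_div_le hc h₀pos hh φ)
  have hsum : ∀ (μ : Measure ℝ) [SFinite μ] (φ ψ : AffP),
      ∫⁻ y, (μ (act φ ⁻¹' Icc y (y + h)) ^ 2 + μ (act ψ ⁻¹' Icc y (y + h)) ^ 2) =
        ENNReal.ofReal h * (energy μ (h / φ.1.1) + energy μ (h / ψ.1.1)) := fun μ _ φ ψ => by
    rw [lintegral_add_left ((measurable_window_act_right μ φ h).pow_const 2),
      lintegral_sq_window_act μ φ hh, lintegral_sq_window_act μ ψ hh, mul_add]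
  have hpair : ∀ z : AffP × AffP, ∫⁻ y, 2 * (F z.1 y * F z.2 y) ≤
      ENNReal.ofReal h * (gainWeight (U₁ ×ˢ U₂) z * (scaleFactor c z.1 + scaleFactor c z.2) *
        (N * gauge c h₀ h)) := by
    rintro ⟨φ, ψ⟩
    by_cases hz : (φ, ψ) ∈ U₁ ×ˢ U₂
    · have hz' : (φ, ψ) ∉ (U₁ ×ˢ U₂)ᶜ := fun h => h hz
      have hw : gainWeight (U₁ ×ˢ U₂) (φ, ψ) = 1 / 4 + 1 / 4 := by
        have h2 : (1 / 2 : ℝ≥0∞) = 1 / 4 + 1 / 4 := by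
          rw [← two_mul, show (4 : ℝ≥0∞) = 2 * 2 by norm_num, one_div, one_div,
            ENNReal.mul_inv (by simp) (by simp), ← mul_assoc,
            ENNReal.mul_inv_cancel (by simp) (by simp), one_mul]
        simp only [gainWeight, indicator_of_mem hz, indicator_of_notMem hz', zero_add, h2]
      rw [hw]
      have hm : ∀ μ : Measure ℝ, [SFinite μ] → Measurable fun y =>
          μ (act φ ⁻¹' Icc y (y + h)) ^ 2 + μ (act ψ ⁻¹' Icc y (y + h)) ^ 2 := fun μ _ =>
        ((measurable_window_act_right μ φ h).pow_const 2).add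
          ((measurable_window_act_right μ ψ h).pow_const 2)
      calc _ ≤ ∫⁻ y, (1 / 4 * (F φ y ^ 2 + F ψ y ^ 2) + 4 * κ ^ 2 *
            (ν (act φ ⁻¹' Icc y (y + h)) ^ 2 + ν (act ψ ⁻¹' Icc y (y + h)) ^ 2)) :=
            lintegral_mono fun y => two_mul_window_le_gain (hsep φ hz.1 ψ hz.2 y)
        _ = 1 / 4 * (ENNReal.ofReal h * (energy σ (h / φ.1.1) + energy σ (h / ψ.1.1))) +
            4 * κ ^ 2 * (ENNReal.ofReal h * (energy ν (h / φ.1.1) + energy ν (h / ψ.1.1))) := by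
            rw [lintegral_add_left ((hm σ).const_mul _), lintegral_const_mul _ (hm σ),
              lintegral_const_mul _ (hm ν), hsum σ, hsum ν]
        _ = ENNReal.ofReal h * (1 / 4 * (energy σ (h / φ.1.1) + energy σ (h / ψ.1.1)) +
            (4 * κ ^ 2 * energy ν (h / φ.1.1) + 4 * κ ^ 2 * energy ν (h / ψ.1.1))) := by ring
        _ ≤ ENNReal.ofReal h * (1 / 4 * (N * (scaleFactor c φ * gauge c h₀ h) +
            N * (scaleFactor c ψ * gauge c h₀ h)) +
            (1 / 4 * (N * (scaleFactor c φ * gauge c h₀ h)) +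
              1 / 4 * (N * (scaleFactor c ψ * gauge c h₀ h)))) := by
            exact mul_le_mul_right (add_le_add
              (mul_le_mul_right (add_le_add (hσ _) (hσ _)) _) (add_le_add (hνφ _) (hνφ _))) _
        _ = _ := by ring
    · have hz' : (φ, ψ) ∈ (U₁ ×ˢ U₂)ᶜ := hz
      have hw : gainWeight (U₁ ×ˢ U₂) (φ, ψ) = 1 := by
        simp [gainWeight, indicator_of_notMem hz, indicator_of_mem hz']
      rw [hw]
      calc _ ≤ ∫⁻ y, (F φ y ^ 2 + F ψ y ^ 2) := lintegral_mono fun y => two_mul_le_sq _ _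
        _ = ENNReal.ofReal h * (energy σ (h / φ.1.1) + energy σ (h / ψ.1.1)) := hsum σ φ ψ
        _ ≤ ENNReal.ofReal h * (N * (scaleFactor c φ * gauge c h₀ h) +
            N * (scaleFactor c ψ * gauge c h₀ h)) := by
            gcongr <;> exact hσ _
        _ = _ := by ring
  have hsq : ∀ y, 2 * σ (Icc y (y + h)) ^ 2 =
      ∫⁻ z : AffP × AffP, 2 * (F z.1 y * F z.2 y) ∂(Q.prod Q) := fun y => by
    have hp : Measurable fun z : AffP × AffP => F z.1 y * F z.2 y :=
      ((hFy y).comp measurable_fst).mul ((hFy y).comp measurable_snd)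
    rw [lintegral_const_mul _ hp,
      lintegral_prod_mul (hFy y).aemeasurable (hFy y).aemeasurable,
      ← hs.measure_eq measurableSet_Icc, sq]
  have hm : Measurable fun w : ℝ × (AffP × AffP) => 2 * (F w.2.1 w.1 * F w.2.2 w.1) := by
    have e1 : Measurable fun w : ℝ × (AffP × AffP) => (w.2.1, w.1) := by fun_prop
    have e2 : Measurable fun w : ℝ × (AffP × AffP) => (w.2.2, w.1) := by fun_prop
    exact ((hFm.comp e1).mul (hFm.comp e2)).const_mul 2
  have hwm : Measurable fun z : AffP × AffP => gainWeight (U₁ ×ˢ U₂) z *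
      (scaleFactor c z.1 + scaleFactor c z.2) :=
    (measurable_gainWeight (hU₁.prod hU₂)).mul (by fun_prop)
  have hmain : ENNReal.ofReal h * (2 * energy σ h) ≤ ENNReal.ofReal h *
      ((∫⁻ z, gainWeight (U₁ ×ˢ U₂) z * (scaleFactor c z.1 + scaleFactor c z.2)
      ∂(Q.prod Q)) * (N * gauge c h₀ h)) := by
    calc ENNReal.ofReal h * (2 * energy σ h) = 2 * ∫⁻ y, σ (Icc y (y + h)) ^ 2 := by
          rw [energy_mul_ofReal σ hh]; ring
      _ = ∫⁻ y, ∫⁻ z : AffP × AffP, 2 * (F z.1 y * F z.2 y) ∂(Q.prod Q) := by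
          rw [← lintegral_const_mul _ ((measurable_window σ h).pow_const 2)]
          exact lintegral_congr hsq
      _ = ∫⁻ z : AffP × AffP, (∫⁻ y, 2 * (F z.1 y * F z.2 y)) ∂(Q.prod Q) :=
          lintegral_lintegral_swap hm.aemeasurable
      _ ≤ _ := lintegral_mono hpair
      _ = _ := by
          rw [lintegral_const_mul _ (hwm.mul_const _), lintegral_mul_const _ hwm]
  exact (ENNReal.mul_le_mul_iff_right (by simp [hh]) (by simp)).1 hmain

lemma le_of_le_max_mul {N D K : ℝ≥0∞} (hN : N ≠ ⊤) (hK : K < 2)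
    (h : N ≤ max (K / 2 * N) D) : N ≤ D := by
  rcases le_max_iff.1 h with h | h
  · rcases eq_or_ne N 0 with h0 | h0
    · simp [h0]
    · exfalso
      have hK1 : K / 2 < 1 := ENNReal.div_lt_of_lt_mul (by simpa using hK)
      have := (ENNReal.mul_lt_mul_iff_left h0 hN).2 hK1
      rw [one_mul] at this
      exact this.not_ge h
  · exact h

/-! ### Power bound for the energy -/

lemma iterate_act_fixed {φ : AffP} {p : ℝ} (hp : act φ p = p) (x : ℝ) (k : ℕ) :
    (act φ)^[k] x = p + φ.1.1 ^ k * (x - p) := by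
  induction k with
  | zero => simp
  | succ k ih =>
    rw [Function.iterate_succ_apply', ih]
    simp only [act] at hp ⊢
    linear_combination hp

lemma tendsto_act_iter {φ : AffP} (hφ : φ.1.1 < 1) {p : ℝ} (hp : act φ p = p) (x : ℝ) :
    Tendsto (fun k => act (iter φ k) x) atTop (𝓝 p) := by
  simp_rw [act_iter, iterate_act_fixed hp]
  simpa using ((tendsto_pow_atTop_nhds_zero_of_lt_one φ.2.le hφ).mul_const (x - p)).const_add p

/-- The affine maps sending `[-R, R]` into the open `e`-neighbourhood of `p`. -/
def nearSet (R p e : ℝ) : Set AffP := {θ | |act θ R - p| < e ∧ |act θ (-R) - p| < e}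

lemma isOpen_nearSet (R p e : ℝ) : IsOpen (nearSet R p e) := by
  have h : ∀ x, Continuous fun θ : AffP => act θ x := fun x =>
    continuous_act.comp (by fun_prop : Continuous fun θ : AffP => (θ, x))
  exact (isOpen_lt ((h R).sub continuous_const).abs continuous_const).inter
    (isOpen_lt ((h (-R)).sub continuous_const).abs continuous_const)

lemma abs_act_sub_lt_of_mem_nearSet {R p e x : ℝ} {θ : AffP} (hθ : θ ∈ nearSet R p e)
    (hx : x ∈ Icc (-R) R) : |act θ x - p| < e := by
  have h1 := (strictMono_act θ).monotone hx.1
  have h2 := (strictMono_act θ).monotone hx.2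
  have h3 := abs_lt.1 hθ.1
  have h4 := abs_lt.1 hθ.2
  exact abs_lt.2 ⟨by linarith, by linarith⟩

/-- Some convolution power charges two sets of maps whose images of a given interval are small and
separated. -/
lemma exists_separated_sets {P : Measure AffP} [IsProbabilityMeasure P]
    (hnofix : ¬ ∃ x, ∀ φ ∈ msupport P, act φ x = x) (hcontr : ∃ φ ∈ msupport P, φ.1.1 < 1) :
    ∃ d > 0, ∀ R, ∃ n, ∃ U₁ U₂ : Set AffP, IsOpen U₁ ∧ IsOpen U₂ ∧ convPow P n U₁ ≠ 0 ∧
      convPow P n U₂ ≠ 0 ∧ ∀ φ ∈ U₁, ∀ ψ ∈ U₂, ∀ y h, h < d →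
        Disjoint (act φ ⁻¹' Icc y (y + h)) (Icc (-R) R) ∨
        Disjoint (act ψ ⁻¹' Icc y (y + h)) (Icc (-R) R) := by
  obtain ⟨φ, hφ, hr⟩ := hcontr
  set p := φ.1.2 / (1 - φ.1.1) with hp
  have hfix : act φ p = p := by
    have : 1 - φ.1.1 ≠ 0 := by linarith
    rw [act, hp]; field_simp; ring
  push Not at hnofix
  obtain ⟨ψ, hψ, hne⟩ := hnofix p
  have hD : 0 < |act ψ p - p| := abs_pos.2 (sub_ne_zero.2 hne)
  set D := |act ψ p - p| with hDdef
  refine ⟨D / 2, by positivity, fun R => ?_⟩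
  have h1 : ∀ x, ∀ᶠ k in atTop, |act (iter φ (k + 1)) x - p| < D / 4 := fun x => by
    have := ((tendsto_act_iter hr hfix x).comp (tendsto_add_atTop_nat 1)).sub_const p
    rw [sub_self] at this
    simpa using this.abs.eventually (gt_mem_nhds (by simpa using hD))
  have h2 : ∀ x, ∀ᶠ k in atTop, |act (comp ψ (iter φ k)) x - act ψ p| < D / 4 := fun x => by
    simp_rw [act_comp]
    have hc : Continuous (act ψ) := by unfold act; fun_prop
    have := (((hc.tendsto p).comp (tendsto_act_iter hr hfix x)).sub_const (act ψ p)).abs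
    rw [sub_self, abs_zero] at this
    exact this.eventually (gt_mem_nhds (by positivity))
  obtain ⟨k, ⟨a1, a2⟩, a3, a4⟩ :=
    (((h1 R).and (h1 (-R))).and ((h2 R).and (h2 (-R)))).exists
  refine ⟨k + 1, nearSet R p (D / 4), nearSet R (act ψ p) (D / 4), isOpen_nearSet _ _ _,
    isOpen_nearSet _ _ _, ?_, ?_, ?_⟩
  · exact (iter_mem_msupport hφ (k + 1) _ (isOpen_nearSet _ _ _) ⟨a1, a2⟩).ne'
  · exact (comp_mem_msupport hψ (iter_mem_msupport hφ k) _ (isOpen_nearSet _ _ _) ⟨a3, a4⟩).ne'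
  · intro θ hθ θ' hθ' y h hh
    by_contra! hcon
    obtain ⟨⟨x, hx, hxR⟩, ⟨x', hx', hxR'⟩⟩ :=
      And.imp not_disjoint_iff.1 not_disjoint_iff.1 hcon
    have e1 := abs_lt.1 (abs_act_sub_lt_of_mem_nearSet hθ hxR)
    have e2 := abs_lt.1 (abs_act_sub_lt_of_mem_nearSet hθ' hxR')
    obtain ⟨b1, b2⟩ := hx
    obtain ⟨b3, b4⟩ := hx'
    have : D < D := by
      nth_rw 1 [hDdef]
      exact abs_lt.2 ⟨by linarith, by linarith⟩
    exact lt_irrefl _ this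

lemma slopePow_sq (s : ℝ) (φ : AffP) : slopePow (s / 2) φ ^ 2 = slopePow s φ := by
  rw [sq, ← slopePow_add, add_halves]

lemma enorm_rpow_sq (s x : ℝ) : (‖x‖ₑ ^ s) ^ 2 = ‖x‖ₑ ^ (2 * s) := by
  rw [mul_comm, ENNReal.rpow_mul]; norm_cast

lemma measure_le_weighted {σ : Measure ℝ} {q R : ℝ} (hq : 0 ≤ q) (hR : 0 < R)
    {J : Set ℝ} (hJ : MeasurableSet J) (hd : Disjoint J (Icc (-R) R)) :
    σ J ≤ ENNReal.ofReal (R ^ (-q)) * weighted q σ J := by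
  rw [weighted, withDensity_apply _ hJ, ← lintegral_const_mul _ (by fun_prop), ← setLIntegral_one]
  refine setLIntegral_mono' hJ fun x hx => ?_
  have hxR : R ≤ |x| := by
    by_contra! h
    exact disjoint_left.1 hd hx (abs_le.1 h.le)
  rw [← ofReal_norm, Real.norm_eq_abs, ENNReal.ofReal_rpow_of_nonneg (abs_nonneg _) hq,
    ← ENNReal.ofReal_mul (by positivity), ENNReal.one_le_ofReal, Real.rpow_neg hR.le,
    inv_mul_eq_div, one_le_div (by positivity)]
  exact Real.rpow_le_rpow hR.le hxR hq

lemma exists_radius {q : ℝ} (hq : 0 < q) {B : ℝ≥0∞} (hB : B ≠ ⊤) :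
    ∃ R : ℝ, 0 < R ∧ 4 * ENNReal.ofReal (R ^ (-q)) ^ 2 * B ≤ 1 / 4 := by
  have h1 : Tendsto (fun R : ℝ => ENNReal.ofReal (R ^ (-q))) atTop (𝓝 0) := by
    simpa using ENNReal.tendsto_ofReal (tendsto_rpow_neg_atTop hq)
  have h2 : Tendsto (fun R : ℝ => 4 * ENNReal.ofReal (R ^ (-q)) ^ 2 * B) atTop (𝓝 0) := by
    simpa using ENNReal.Tendsto.mul_const
      (ENNReal.Tendsto.const_mul (a := 4) (ENNReal.Tendsto.pow (n := 2) h1) (Or.inr (by simp))) (Or.inr hB)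
  obtain ⟨R, hR, hR0⟩ := ((h2.eventually (ge_mem_nhds (by simp : (0 : ℝ≥0∞) < 1 / 4))).and
    (eventually_gt_atTop 0)).exists
  exact ⟨R, hR0, hR⟩

/-- The self-improvement step: the least constant in a power bound is explicit. -/
lemma Stationary.energy_le_gauge {P Q : Measure AffP} [IsProbabilityMeasure P]
    [IsProbabilityMeasure Q] {σ : Measure ℝ} [IsProbabilityMeasure σ] (hP : Stationary P σ)
    (hQ : Stationary Q σ) {q R : ℝ} (hq : 0 ≤ q) (hq1 : q ≤ 1) (hR : 0 < R)
    [IsFiniteMeasure (weighted q σ)] {c h₀ : ℝ} (hc : 0 ≤ c) (h₀pos : 0 < h₀) {B : ℝ≥0∞}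
    (hA : ∫⁻ φ, slopePow q φ ^ 2 * scaleFactor c φ ∂P ≤ 1 / 4)
    (hB : ∫⁻ φ : AffP, (‖φ.1.2‖ₑ ^ q) ^ 2 * scaleFactor c φ ∂P ≤ B)
    (hRB : 4 * ENNReal.ofReal (R ^ (-q)) ^ 2 * (4 * B) ≤ 1 / 4)
    {U₁ U₂ : Set AffP} (hU₁ : MeasurableSet U₁) (hU₂ : MeasurableSet U₂) {d : ℝ} (hd : 0 < d)
    (hsep : ∀ φ ∈ U₁, ∀ ψ ∈ U₂, ∀ y h, h < d →
        Disjoint (act φ ⁻¹' Icc y (y + h)) (Icc (-R) R) ∨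
        Disjoint (act ψ ⁻¹' Icc y (y + h)) (Icc (-R) R))
    (hM : 2 * ∫⁻ φ, scaleFactor c φ ∂Q < 2 + Q U₁ * Q U₂) {h : ℝ} (hh : 0 < h) :
    energy σ h ≤ ENNReal.ofReal (d ^ (-c)) * gauge c h₀ h := by
  have hbound : ∀ {d : ℝ}, 0 < d → ∀ h > 0, d ≤ h + h₀ →
      energy σ h ≤ ENNReal.ofReal (d ^ (-c)) * gauge c h₀ h := fun {d} hd h hh hdh => by
    refine (energy_le_sq σ hh).trans ?_
    rw [measure_univ, one_pow, gauge, ← ENNReal.ofReal_mul (by positivity), ENNReal.one_le_ofReal,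
      Real.rpow_neg hd.le, inv_mul_eq_div, one_le_div (by positivity)]
    exact Real.rpow_le_rpow hd.le hdh hc
  obtain ⟨N, hN, hNle, hNmin⟩ := exists_least_const (u := energy σ) (g := gauge c h₀)
    (fun h hh => gauge_ne_zero h₀pos hh) (fun h _ => gauge_ne_top c h₀ h)
    ENNReal.ofReal_ne_top (fun h hh => hbound h₀pos h hh (by linarith))
  set K := ∫⁻ z, gainWeight (U₁ ×ˢ U₂) z * (scaleFactor c z.1 + scaleFactor c z.2) ∂(Q.prod Q)
    with hK
  have hK2 : K < 2 := by
    have := (lintegral_gainWeight_add_le Q (measurable_scaleFactor c) (one_le_scaleFactor c)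
      hU₁ hU₂).trans_lt hM
    exact lt_of_add_lt_add_right this
  have hνle := hP.energy_weighted_le_gauge hq hq1 hc h₀pos hA hB hNle
  have hmeas : ∀ (φ : AffP) (y h : ℝ), MeasurableSet (act φ ⁻¹' Icc y (y + h)) := fun φ y h =>
    (by fun_prop : Measurable (act φ)) measurableSet_Icc
  have hND : N ≤ ENNReal.ofReal (d ^ (-c)) := by
    refine le_of_le_max_mul hN hK2 (hNmin _ fun k hk => ?_)
    rcases lt_or_ge k d with hkd | hkd
    · have hgain : 2 * energy σ k ≤ K * (N * gauge c h₀ k) := by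
        refine hQ.energy_gain (ν := weighted q σ) (κ := ENNReal.ofReal (R ^ (-q))) hc h₀pos hU₁ hU₂
          hk (fun φ hφ ψ hψ y => ?_) hNle fun k hk => ?_
        · exact (hsep φ hφ ψ hψ y k hkd).imp (measure_le_weighted hq hR (hmeas _ _ _))
            (measure_le_weighted hq hR (hmeas _ _ _))
        · calc _ ≤ 4 * ENNReal.ofReal (R ^ (-q)) ^ 2 * (4 * B * N * gauge c h₀ k) := by
                gcongr; exact hνle k hk
            _ = 4 * ENNReal.ofReal (R ^ (-q)) ^ 2 * (4 * B) * (N * gauge c h₀ k) := by ring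
            _ ≤ _ := by gcongr
      calc energy σ k = 2 * energy σ k / 2 := by
            rw [mul_comm, ENNReal.mul_div_cancel_right (by simp) (by simp)]
        _ ≤ K * (N * gauge c h₀ k) / 2 := by gcongr
        _ = K / 2 * N * gauge c h₀ k := by simp only [div_eq_mul_inv]; ring
        _ ≤ _ := by gcongr; exact le_max_left _ _
    · refine (hbound hd k hk (by linarith)).trans ?_
      gcongr
      exact le_max_right _ _
  exact (hNle h hh).trans (by gcongr)

/-- The energy of a stationary measure decays at least like a power of the scale. -/
lemma exists_energy_le_rpow {P : Measure AffP} [IsProbabilityMeasure P]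
    {σ : Measure ℝ} [IsProbabilityMeasure σ] (hs : Stationary P σ) {ε : ℝ} (hε : 0 < ε)
    (hmom : ∫⁻ φ : AffP, ENNReal.ofReal (φ.1.1 ^ ε + φ.1.1 ^ (-ε) + |φ.1.2| ^ ε) ∂P < ⊤)
    (hnofix : ¬ ∃ x, ∀ φ ∈ msupport P, act φ x = x) :
    ∃ c K : ℝ, 0 < c ∧ 0 < K ∧ ∀ h > 0, energy σ h ≤ ENNReal.ofReal (K * h ^ c) := by
  have hdrift := drift_neg hs hnofix (integrable_log_slope hε hmom)
  obtain ⟨p, hp, hpb, hp1⟩ := exists_contracting_exponent hε hmom hdrift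
    (b := min ε 1 / 2) (by positivity) (by linarith [min_le_left ε 1])
  have hpε : 2 * p ≤ ε := by linarith [min_le_left ε 1]
  have hp2 : 2 * p ≤ 1 := by linarith [min_le_right ε 1]
  have hslope : ∀ s, |s| ≤ ε → ∀ n, ∫⁻ φ, slopePow s φ ∂(convPow P n) ≠ ⊤ := fun s hsε n => by
    rw [lintegral_slopePow_convPow]
    exact ENNReal.pow_ne_top (lintegral_slopePow_ne_top hmom hsε)
  have hscale : ∀ n, ∫⁻ φ, scaleFactor (2 * (ε / 2)) φ ∂(convPow P n) ≠ ⊤ := fun n => by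
    refine lintegral_scaleFactor_ne_top (hslope _ ?_ n)
    rw [abs_neg, mul_div_cancel₀ _ two_ne_zero, abs_of_pos hε]
  have hq1 : ∫⁻ φ, slopePow (p / 2) φ ∂P < 1 := by
    by_contra! hge
    have h2 := sq_lintegral_le P (measurable_slopePow (p / 2))
    simp_rw [slopePow_sq] at h2
    exact (one_le_pow₀ hge |>.trans h2).not_gt hp1
  have hmoment := hs.moment_ne_top (half_pos hp) (by linarith) hq1
    (lintegral_translation_ne_top hmom (by linarith) (by linarith))
  have : IsFiniteMeasure (weighted (p / 2) σ) := isFiniteMeasure_withDensity hmoment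
  obtain ⟨m, hm⟩ := ((ENNReal.tendsto_pow_atTop_nhds_zero_of_lt_one hp1).eventually
    (gt_mem_nhds (by simp : (0 : ℝ≥0∞) < 1 / 4))).exists
  have hmt : Measurable fun φ : AffP => (‖φ.1.2‖ₑ ^ (p / 2)) ^ 2 := by fun_prop
  have hA := tendsto_lintegral_mul_scaleFactor (convPow P m) ((measurable_slopePow (p / 2)).pow_const 2)
    hp (by
      simp_rw [slopePow_sq]
      exact lintegral_slopePow_mul_scaleFactor_ne_top (hslope p (by rw [abs_of_pos hp]; linarith) m))
  have hB := tendsto_lintegral_mul_scaleFactor (convPow P m) hmt (half_pos hε)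
    (lintegral_mul_scaleFactor_ne_top (hscale m) hmt (by
      have hsq : ∀ φ : AffP, ((‖φ.1.2‖ₑ ^ (p / 2)) ^ 2) ^ 2 = ‖φ.1.2‖ₑ ^ (2 * p) := fun φ => by
        rw [enorm_rpow_sq, enorm_rpow_sq]; congr 1; ring
      simp_rw [hsq]
      exact lintegral_translation_convPow_ne_top (by linarith) hp2
        (lintegral_slopePow_ne_top hmom (by rw [abs_of_pos (by linarith)]; exact hpε))
        (lintegral_translation_ne_top hmom (by linarith) hpε) m))
  set B := ∫⁻ φ : AffP, (‖φ.1.2‖ₑ ^ (p / 2)) ^ 2 ∂(convPow P m) with hBdef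
  have hBtop : B ≠ ⊤ := by
    rw [hBdef]
    simp_rw [enorm_rpow_sq]
    rw [mul_div_cancel₀ _ two_ne_zero]
    exact lintegral_translation_convPow_ne_top hp (by linarith)
      (lintegral_slopePow_ne_top hmom (by rw [abs_of_pos hp]; linarith))
      (lintegral_translation_ne_top hmom hp.le (by linarith)) m
  simp_rw [slopePow_sq, lintegral_slopePow_convPow] at hA
  obtain ⟨R, hR, hRB⟩ := exists_radius (half_pos hp) (B := 4 * (B + 1))
    (ENNReal.mul_ne_top (by simp) (by simp [hBtop]))
  obtain ⟨d, hd, hsets⟩ := exists_separated_sets hnofix (exists_contracting_of_drift hdrift)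
  obtain ⟨n, U₁, U₂, hU₁, hU₂, hpos₁, hpos₂, hsep⟩ := hsets R
  have hM := tendsto_lintegral_mul_scaleFactor (convPow P n) (measurable_const (a := 1))
    (half_pos hε) (lintegral_mul_scaleFactor_ne_top (hscale n) measurable_const (by simp))
  simp only [one_mul, lintegral_const, measure_univ] at hM
  have hM2 : Tendsto (fun c => 2 * ∫⁻ φ, scaleFactor c φ ∂(convPow P n)) (𝓝[>] 0) (𝓝 2) := by
    simpa using ENNReal.Tendsto.const_mul (a := 2) hM (Or.inl one_ne_zero)
  obtain ⟨c, ⟨hcA, hcB⟩, hcM, hc⟩ := (((hA.eventually (gt_mem_nhds hm)).and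
    (hB.eventually (gt_mem_nhds (ENNReal.lt_add_right hBtop one_ne_zero)))).and
    ((hM2.eventually (gt_mem_nhds (ENNReal.lt_add_right (by simp)
      (mul_ne_zero hpos₁ hpos₂)))).and self_mem_nhdsWithin)).exists
  have hc0 : 0 < c := hc
  refine ⟨c, d ^ (-c) * 2 ^ c, hc0, by positivity, fun h hh => ?_⟩
  refine ((hs.convPow m).energy_le_gauge (hs.convPow n) (half_pos hp).le (by linarith) hR hc0.le hh
    (by simp_rw [slopePow_sq]; exact hcA.le) hcB.le hRB hU₁.measurableSet hU₂.measurableSet hd hsep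
    hcM hh).trans (le_of_eq ?_)
  rw [gauge, ← ENNReal.ofReal_mul (by positivity), ← two_mul, Real.mul_rpow two_pos.le hh.le,
    mul_assoc]

lemma energy_kernel_bound {t δ s : ℝ} (ht : 1 < t) (hδ : 0 < δ) :
    ENNReal.ofReal ((max 1 (t * |s|)) ^ (-δ)) ≤
      2 * ENNReal.ofReal (1 - |s| / (2 * t ^ (-(1 / 2) : ℝ))) +
        ENNReal.ofReal (t ^ (-(δ / 2))) := by
  have ht0 : 0 < t := by linarith
  set ρ := t ^ (-(1 / 2) : ℝ) with hρ
  have hρ0 : 0 < ρ := by positivity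
  rcases le_total |s| ρ with h | h
  · refine le_add_right ?_
    rw [← ENNReal.ofReal_ofNat, ← ENNReal.ofReal_mul zero_le_two]
    refine ENNReal.ofReal_le_ofReal ?_
    calc (max 1 (t * |s|)) ^ (-δ) ≤ 1 :=
          Real.rpow_le_one_of_one_le_of_nonpos (le_max_left _ _) (by linarith)
      _ ≤ 2 * (1 - |s| / (2 * ρ)) := by
          have : |s| / (2 * ρ) ≤ 1 / 2 := by rw [div_le_div_iff₀ (by positivity) two_pos]; linarith
          linarith
  · refine le_add_left (ENNReal.ofReal_le_ofReal ?_)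
    have h1 : t ^ (1 / 2 : ℝ) ≤ max 1 (t * |s|) := by
      refine le_trans (le_trans (le_of_eq ?_) (mul_le_mul_of_nonneg_left h ht0.le))
        (le_max_right _ _)
      rw [hρ]
      nth_rw 2 [← Real.rpow_one t]
      rw [← Real.rpow_add ht0]; norm_num
    calc (max 1 (t * |s|)) ^ (-δ) ≤ (t ^ (1 / 2 : ℝ)) ^ (-δ) :=
          Real.rpow_le_rpow_of_nonpos (by positivity) h1 (by linarith)
      _ = t ^ (-(δ / 2)) := by rw [← Real.rpow_mul ht0.le]; congr 1; ring

lemma lintegral_correlation_le (σ : Measure ℝ) [IsProbabilityMeasure σ] {t δ : ℝ} (ht : 1 < t)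
    (hδ : 0 < δ) :
    ∫⁻ s₁, ∫⁻ s₂, ENNReal.ofReal ((max 1 (t * |s₁ - s₂|)) ^ (-δ)) ∂σ ∂σ ≤
      2 * energy σ (2 * t ^ (-(1 / 2) : ℝ)) + ENNReal.ofReal (t ^ (-(δ / 2))) := by
  have hρ : 0 < 2 * t ^ (-(1 / 2) : ℝ) := by positivity
  refine (lintegral_mono fun s₁ => lintegral_mono fun s₂ => energy_kernel_bound ht hδ).trans ?_
  rw [energy_eq_kernel σ hρ]
  set ρ := 2 * t ^ (-(1 / 2) : ℝ)
  have hm : Measurable fun s₁ : ℝ => ∫⁻ s₂, ENNReal.ofReal (1 - |s₁ - s₂| / ρ) ∂σ :=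
    Measurable.lintegral_prod_right' (f := fun z : ℝ × ℝ => ENNReal.ofReal
      (1 - |z.1 - z.2| / ρ)) (by fun_prop)
  have hinner : ∀ s₁, ∫⁻ s₂, (2 * ENNReal.ofReal (1 - |s₁ - s₂| / ρ) +
      ENNReal.ofReal (t ^ (-(δ / 2)))) ∂σ =
      2 * ∫⁻ s₂, ENNReal.ofReal (1 - |s₁ - s₂| / ρ) ∂σ + ENNReal.ofReal (t ^ (-(δ / 2))) :=
    fun s₁ => by
      rw [lintegral_add_right _ measurable_const, lintegral_const_mul _ (by fun_prop)]
      simp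
  simp_rw [hinner]
  rw [lintegral_add_right _ measurable_const, lintegral_const_mul _ hm]
  simp

end CorrelationDecay

/-- Polynomial decay of the correlation integral
`∬ max(1, t|s₁ − s₂|)^{−δ} dσ(s₁) dσ(s₂) ≤ C t^{−c}`. -/
theorem correlation_integral_decay
    (lam : Measure AffP) [IsProbabilityMeasure lam]
    (hmom : ∃ ε : ℝ, 0 < ε ∧
      ∫⁻ φ : AffP, ENNReal.ofReal (φ.1.1 ^ ε + φ.1.1 ^ (-ε) + |φ.1.2| ^ ε) ∂lam < ⊤)
    (hnofix : ¬ ∃ t : ℝ, ∀ φ ∈ msupport lam, φ.1.1 * t + φ.1.2 = t)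
    (σ : Measure ℝ) [IsProbabilityMeasure σ]
    (hstat : ∀ A : Set ℝ, MeasurableSet A →
      σ A = ∫⁻ φ : AffP, σ ((fun t => φ.1.1 * t + φ.1.2) ⁻¹' A) ∂lam) :
    ∀ δ : ℝ, 0 < δ → ∃ c C : ℝ, 0 < c ∧ 0 < C ∧
      ∀ t : ℝ, 1 < t →
        ∫⁻ s₁, ∫⁻ s₂, ENNReal.ofReal ((max 1 (t * |s₁ - s₂|)) ^ (-δ)) ∂σ ∂σ ≤
          ENNReal.ofReal (C * t ^ (-c)) := by
  intro δ hδ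
  obtain ⟨ε, hε, hmom⟩ := hmom
  obtain ⟨c, K, hc, hK, henergy⟩ :=
    CorrelationDecay.exists_energy_le_rpow (CorrelationDecay.stationary_of_sets hstat) hε hmom hnofix
  refine ⟨min c δ / 2, 2 * (K * 2 ^ c) + 1, by positivity, by positivity, fun t ht => ?_⟩
  have ht0 : 0 < t := by linarith
  refine (CorrelationDecay.lintegral_correlation_le σ ht hδ).trans ?_
  have h1 : (2 * t ^ (-(1 / 2) : ℝ)) ^ c ≤ 2 ^ c * t ^ (-(min c δ / 2)) := by
    rw [Real.mul_rpow two_pos.le (by positivity), ← Real.rpow_mul ht0.le]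
    gcongr
    · exact ht.le
    · linarith [min_le_left c δ]
  have h2 : t ^ (-(δ / 2)) ≤ t ^ (-(min c δ / 2)) := by
    gcongr
    · exact ht.le
    · exact min_le_right c δ
  calc _ ≤ 2 * ENNReal.ofReal (K * (2 ^ c * t ^ (-(min c δ / 2)))) +
        ENNReal.ofReal (t ^ (-(min c δ / 2))) := by
        gcongr
        exact (henergy _ (by positivity)).trans (by gcongr)
    _ = _ := by
        rw [← ENNReal.ofReal_ofNat, ← ENNReal.ofReal_mul zero_le_two,
          ← ENNReal.ofReal_add (by positivity) (by positivity)]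
        congr 1
        ring
end

section
/- Let (Ω, P) be a probability space, (Y_k)_{k≥1} a sequence of non-negative real random variables, (y_k)_{k≥1} a sequence in [0,1], and Z_k := Y_k − y_k. Assume Σ_{k=1}^∞ y_k = +∞ and that for some C₁ ≥ 1: for all n ≥ m ≥ 1, E[(Σ_{k=m}^n Z_k)²] ≤ C₁ Σ_{k=m}^n y_k. Then almost surely there is a constant C₂ > 1 such that for all n ≥ 1: |Σ_{k=1}^n Z_k| ≤ C₂ · max(1, (Σ_{k=1}^n y_k)^{1/2} · log²(Σ_{k=1}^n y_k)). -/
open MeasureTheory Filter Topology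

/-- The dyadic chaining bound: an increment over `[0, j]` is controlled by the squared increments
over all dyadic intervals inside `[0, 2 ^ r]`. -/
theorem sq_sub_zero_le_dyadic (x : ℕ → ℝ) {r j : ℕ} (hj : j < 2 ^ r) :
    (x j - x 0) ^ 2 ≤ r * ∑ s ∈ Finset.range r, ∑ t ∈ Finset.range (2 ^ (r - s)),
      (x ((t + 1) * 2 ^ s) - x (t * 2 ^ s)) ^ 2 := by
  have htel : x j - x 0 = ∑ s ∈ Finset.range r,
      (x (j / 2 ^ s * 2 ^ s) - x (j / 2 ^ (s + 1) * 2 ^ (s + 1))) := by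
    rw [Finset.sum_range_sub' (fun s => x (j / 2 ^ s * 2 ^ s))]
    simp [Nat.div_eq_of_lt hj]
  have hcs := sq_sum_le_card_mul_sum_sq (s := Finset.range r)
    (f := fun s => x (j / 2 ^ s * 2 ^ s) - x (j / 2 ^ (s + 1) * 2 ^ (s + 1)))
  rw [htel]
  refine hcs.trans ?_
  rw [Finset.card_range]
  refine mul_le_mul_of_nonneg_left (Finset.sum_le_sum fun s hs => ?_) (Nat.cast_nonneg r)
  have hsr : s < r := Finset.mem_range.1 hs
  have hdiv : j / 2 ^ (s + 1) = j / 2 ^ s / 2 := by rw [pow_succ, Nat.div_div_eq_div_mul]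
  have hlt : j / 2 ^ s < 2 ^ (r - s) := by
    rw [Nat.div_lt_iff_lt_mul (by positivity), ← pow_add, Nat.sub_add_cancel hsr.le]
    exact hj
  set q := j / 2 ^ s with hq
  rcases Nat.even_or_odd' q with ⟨c, hc | hc⟩
  · have : j / 2 ^ (s + 1) * 2 ^ (s + 1) = q * 2 ^ s := by
      rw [hdiv, hc, Nat.mul_div_cancel_left c two_pos]; ring
    rw [this, sub_self, zero_pow two_ne_zero]
    positivity
  · have : j / 2 ^ (s + 1) * 2 ^ (s + 1) = 2 * c * 2 ^ s := by
      rw [hdiv, hc, show (2 * c + 1) / 2 = c by omega]; ring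
    rw [this, hc]
    exact Finset.single_le_sum
      (f := fun t => (x ((t + 1) * 2 ^ s) - x (t * 2 ^ s)) ^ 2)
      (fun t _ => sq_nonneg _) (Finset.mem_range.2 (by omega : 2 * c < 2 ^ (r - s)))

/-- A Rademacher–Menshov type bound: a sequence whose increments have second moment at most linear
in the length is almost surely `O(√N log² N)` along dyadic scales. -/
theorem ae_exists_forall_abs_sub_zero_le {Ω : Type*} [MeasurableSpace Ω] (P : Measure Ω)
    (X : ℕ → Ω → ℝ) (hX : ∀ j, Measurable (X j)) {C : ℝ} (hC : 0 ≤ C)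
    (h : ∀ i j : ℕ, i < j → ∫⁻ ω, ENNReal.ofReal ((X j ω - X i ω) ^ 2) ∂P ≤
      ENNReal.ofReal (C * ((j : ℝ) - i))) :
    ∀ᵐ ω ∂P, ∃ K : ℝ, 0 ≤ K ∧ ∀ r j : ℕ, j < 2 ^ r →
      |X j ω - X 0 ω| ≤ K * (Real.sqrt (2 ^ r) * ((r : ℝ) + 1) ^ 2) := by
  let D : ℕ → Ω → ℝ := fun r ω => ∑ s ∈ Finset.range r, ∑ t ∈ Finset.range (2 ^ (r - s)),
    (X ((t + 1) * 2 ^ s) ω - X (t * 2 ^ s) ω) ^ 2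
  have hD0 : ∀ r ω, 0 ≤ D r ω := fun r ω =>
    Finset.sum_nonneg fun s _ => Finset.sum_nonneg fun t _ => sq_nonneg _
  have hDm : ∀ r, Measurable (D r) := fun r => by
    refine Finset.measurable_fun_sum _ fun s _ => Finset.measurable_fun_sum _ fun t _ => ?_
    exact ((hX _).sub (hX _)).pow_const 2
  have hDint : ∀ r, ∫⁻ ω, ENNReal.ofReal (D r ω) ∂P ≤ ENNReal.ofReal (r * (C * 2 ^ r)) := by
    intro r
    have h1 : ∀ ω, ENNReal.ofReal (D r ω) = ∑ s ∈ Finset.range r,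
        ∑ t ∈ Finset.range (2 ^ (r - s)),
          ENNReal.ofReal ((X ((t + 1) * 2 ^ s) ω - X (t * 2 ^ s) ω) ^ 2) := fun ω => by
      rw [ENNReal.ofReal_sum_of_nonneg fun s _ => Finset.sum_nonneg fun t _ => sq_nonneg _]
      exact Finset.sum_congr rfl fun s _ => ENNReal.ofReal_sum_of_nonneg fun t _ => sq_nonneg _
    have hm : ∀ s t, Measurable fun ω =>
        ENNReal.ofReal ((X ((t + 1) * 2 ^ s) ω - X (t * 2 ^ s) ω) ^ 2) := fun s t =>
      (((hX _).sub (hX _)).pow_const 2).ennreal_ofReal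
    simp_rw [h1]
    rw [lintegral_finsetSum _ fun s _ => Finset.measurable_fun_sum _ fun t _ => hm s t]
    have h2 : ∀ s ∈ Finset.range r, ∫⁻ ω, ∑ t ∈ Finset.range (2 ^ (r - s)),
        ENNReal.ofReal ((X ((t + 1) * 2 ^ s) ω - X (t * 2 ^ s) ω) ^ 2) ∂P ≤
          ENNReal.ofReal (C * 2 ^ r) := by
      intro s hs
      rw [lintegral_finsetSum _ fun t _ => hm s t]
      have h3 : ∀ t ∈ Finset.range (2 ^ (r - s)),
          ∫⁻ ω, ENNReal.ofReal ((X ((t + 1) * 2 ^ s) ω - X (t * 2 ^ s) ω) ^ 2) ∂P ≤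
            ENNReal.ofReal (C * 2 ^ s) := by
        intro t _
        refine (h _ _ (Nat.mul_lt_mul_of_pos_right t.lt_succ_self (by positivity))).trans
          (le_of_eq ?_)
        push_cast
        ring_nf
      refine (Finset.sum_le_sum h3).trans (le_of_eq ?_)
      rw [Finset.sum_const, Finset.card_range, ← ENNReal.ofReal_nsmul]
      congr 1
      rw [nsmul_eq_mul]
      push_cast
      rw [mul_left_comm, ← pow_add, Nat.sub_add_cancel (Finset.mem_range.1 hs).le]
    refine (Finset.sum_le_sum h2).trans (le_of_eq ?_)
    rw [Finset.sum_const, Finset.card_range, ← ENNReal.ofReal_nsmul, nsmul_eq_mul]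
  let c : ℕ → ℝ := fun r => (2 ^ r * ((r : ℝ) + 1) ^ 3)⁻¹
  have hc0 : ∀ r, 0 < c r := fun r => by positivity
  have hFm : ∀ r, Measurable fun ω => ENNReal.ofReal (c r * D r ω) := fun r =>
    ((hDm r).const_mul _).ennreal_ofReal
  have hFint : ∀ r, ∫⁻ ω, ENNReal.ofReal (c r * D r ω) ∂P ≤
      ENNReal.ofReal (C * (1 / (((r + 1 : ℕ) : ℝ)) ^ 2)) := by
    intro r
    simp_rw [ENNReal.ofReal_mul (hc0 r).le]
    rw [lintegral_const_mul _ (hDm r).ennreal_ofReal]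
    refine (mul_le_mul_right (hDint r) _).trans ?_
    rw [← ENNReal.ofReal_mul (hc0 r).le]
    refine ENNReal.ofReal_le_ofReal ?_
    have : c r * (r * (C * 2 ^ r)) = C * (r / ((r : ℝ) + 1) ^ 3) := by
      simp only [c]; field_simp
    rw [this]
    refine mul_le_mul_of_nonneg_left ?_ hC
    push_cast
    rw [div_le_div_iff₀ (by positivity) (by positivity)]
    nlinarith [sq_nonneg ((r : ℝ) + 1)]
  have hsum : Summable fun r : ℕ => C * (1 / (((r + 1 : ℕ) : ℝ)) ^ 2) :=
    ((summable_nat_add_iff 1).2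
      (Real.summable_one_div_nat_pow.2 one_lt_two)).mul_left C
  have hfin : ∫⁻ ω, ∑' r, ENNReal.ofReal (c r * D r ω) ∂P ≠ ⊤ := by
    rw [lintegral_tsum fun r => (hFm r).aemeasurable]
    exact ne_top_of_le_ne_top hsum.tsum_ofReal_ne_top (ENNReal.tsum_le_tsum hFint)
  filter_upwards [ae_lt_top (Measurable.tsum hFm) hfin] with ω hω
  set K := (∑' r, ENNReal.ofReal (c r * D r ω)).toReal with hK
  refine ⟨Real.sqrt K, Real.sqrt_nonneg _, fun r j hj => ?_⟩
  have hDK : D r ω ≤ K * (2 ^ r * ((r : ℝ) + 1) ^ 3) := by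
    have h1 : c r * D r ω ≤ K :=
      (ENNReal.ofReal_le_iff_le_toReal hω.ne).1
        (ENNReal.le_tsum (f := fun r => ENNReal.ofReal (c r * D r ω)) r)
    simp only [c] at h1
    rw [inv_mul_eq_div] at h1
    exact (div_le_iff₀ (by positivity)).1 h1
  have hK0 : 0 ≤ K := ENNReal.toReal_nonneg
  refine abs_le_of_sq_le_sq ?_ (by positivity)
  have hsq : (Real.sqrt K * (Real.sqrt (2 ^ r) * ((r : ℝ) + 1) ^ 2)) ^ 2 =
      ((r : ℝ) + 1) * (K * (2 ^ r * ((r : ℝ) + 1) ^ 3)) := by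
    rw [mul_pow, mul_pow, Real.sq_sqrt hK0, Real.sq_sqrt (by positivity)]
    ring
  rw [hsq]
  refine (sq_sub_zero_le_dyadic (fun j => X j ω) hj).trans ?_
  exact mul_le_mul (by linarith) hDK (hD0 r ω) (by positivity)

/-- If `2 ^ r ≤ 4 a`, then `√(2 ^ r) (r + 1)²` is `O(√a log² a)`. -/
theorem sqrt_two_pow_mul_sq_le {a : ℝ} (ha : 2 ≤ a) {r : ℕ} (hr : (2 : ℝ) ^ r ≤ 4 * a) :
    Real.sqrt (2 ^ r) * ((r : ℝ) + 1) ^ 2 ≤ 72 * (Real.sqrt a * Real.log a ^ 2) := by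
  have h1 : Real.sqrt (2 ^ r) ≤ 2 * Real.sqrt a := by
    refine (Real.sqrt_le_sqrt hr).trans (le_of_eq ?_)
    rw [Real.sqrt_mul (by norm_num), show (4 : ℝ) = 2 ^ 2 by norm_num,
      Real.sqrt_sq (by norm_num)]
  have hlog2 : Real.log 2 ≤ Real.log a := Real.log_le_log two_pos ha
  have h2 : r * Real.log 2 ≤ 2 * Real.log 2 + Real.log a := by
    have := Real.log_le_log (by positivity) hr
    rw [Real.log_pow, Real.log_mul (by norm_num) (by positivity),
      show (4 : ℝ) = 2 ^ 2 by norm_num, Real.log_pow] at this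
    exact_mod_cast this
  have h3 : (r : ℝ) + 1 ≤ 6 * Real.log a := by
    have := Real.log_two_gt_d9
    nlinarith
  calc Real.sqrt (2 ^ r) * ((r : ℝ) + 1) ^ 2
      ≤ (2 * Real.sqrt a) * (6 * Real.log a) ^ 2 := by gcongr
    _ = 72 * (Real.sqrt a * Real.log a ^ 2) := by ring

/-- Schmidt-type lemma on sums of random variables with controlled variance of
partial sums. -/
theorem schmidt_lemma
    {Ω : Type*} [MeasurableSpace Ω] (P : Measure Ω) [IsProbabilityMeasure P]
    (Y : ℕ → Ω → ℝ) (hYmeas : ∀ k, Measurable (Y k)) (hYpos : ∀ k ω, 0 ≤ Y k ω)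
    (y : ℕ → ℝ) (hy : ∀ k, y k ∈ Set.Icc (0 : ℝ) 1)
    (hdiv : ¬ Summable y)
    (C₁ : ℝ) (hC₁ : 1 ≤ C₁)
    (hvar : ∀ m n : ℕ, 1 ≤ m → m ≤ n →
      ∫⁻ ω, ENNReal.ofReal ((∑ k ∈ Finset.Icc m n, (Y k ω - y k)) ^ 2) ∂P ≤
        ENNReal.ofReal (C₁ * ∑ k ∈ Finset.Icc m n, y k)) :
    ∀ᵐ ω ∂P, ∃ C₂ : ℝ, 1 < C₂ ∧ ∀ n : ℕ, 1 ≤ n →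
      |∑ k ∈ Finset.Icc 1 n, (Y k ω - y k)| ≤
        C₂ * max 1 (Real.sqrt (∑ k ∈ Finset.Icc 1 n, y k) *
          (Real.log (∑ k ∈ Finset.Icc 1 n, y k)) ^ 2) := by
  set Φ : ℕ → ℝ := fun n => ∑ k ∈ Finset.Icc 1 n, y k with hΦ
  let S : ℕ → Ω → ℝ := fun n ω => ∑ k ∈ Finset.Icc 1 n, (Y k ω - y k)
  have hsplit : ∀ (f : ℕ → ℝ) {m n : ℕ}, m ≤ n → ∑ k ∈ Finset.Icc 1 n, f k =
      ∑ k ∈ Finset.Icc 1 m, f k + ∑ k ∈ Finset.Icc (m + 1) n, f k := by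
    intro f m n hmn
    have := Finset.sum_Ioc_consecutive f (Nat.zero_le m) hmn
    simpa only [← Finset.Icc_add_one_left_eq_Ioc, zero_add] using this.symm
  have hΦmono : Monotone Φ := fun m n hmn => by
    have := hsplit y hmn
    have h0 : 0 ≤ ∑ k ∈ Finset.Icc (m + 1) n, y k := Finset.sum_nonneg fun k _ => (hy k).1
    simp only [hΦ]
    linarith
  have hΦ0 : Φ 0 = 0 := by simp [hΦ]
  have hΦsucc : ∀ n, Φ (n + 1) ≤ Φ n + 1 := fun n => by
    have := Finset.sum_Icc_succ_top (Nat.le_add_left 1 n) y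
    have := (hy (n + 1)).2
    simp only [hΦ]
    linarith
  have hunb : ∀ j : ℕ, ∃ n, (j : ℝ) ≤ Φ n := by
    have h1 := (not_summable_iff_tendsto_nat_atTop_of_nonneg fun n => (hy n).1).1 hdiv
    intro j
    obtain ⟨n, hn⟩ := (h1.eventually_ge_atTop ((j : ℝ) + 1)).exists
    refine ⟨n, ?_⟩
    have h2 : ∑ k ∈ Finset.range n, y k ≤ y 0 + Φ n := by
      have : ∑ k ∈ Finset.range n, y k ≤ ∑ k ∈ Finset.range (n + 1), y k :=
        Finset.sum_le_sum_of_subset_of_nonneg (Finset.range_mono n.le_succ)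
          fun k _ _ => (hy k).1
      rw [Finset.sum_range_succ'] at this
      rw [hΦ]
      simp only [Finset.range_eq_Ico, Finset.sum_Ico_add' y 0 n 1, zero_add,
        Finset.Ico_add_one_right_eq_Icc] at this ⊢
      linarith
    linarith [(hy 0).2]
  classical
  let N : ℕ → ℕ := fun j => Nat.find (hunb j)
  have hN1 : ∀ j : ℕ, (j : ℝ) ≤ Φ (N j) := fun j => Nat.find_spec (hunb j)
  have hNle : ∀ {j n : ℕ}, (j : ℝ) ≤ Φ n → N j ≤ n := fun h => Nat.find_min' _ h
  have hN0 : N 0 = 0 := Nat.le_zero.1 (hNle (by simp [hΦ0]))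
  have hN2 : ∀ j : ℕ, Φ (N j) ≤ j + 1 := by
    intro j
    rcases Nat.eq_zero_or_pos (N j) with h0 | hpos
    · rw [h0, hΦ0]; positivity
    · have hlt : Φ (N j - 1) < j := not_le.1 (Nat.find_min (hunb j) (Nat.sub_lt hpos one_pos))
      have := hΦsucc (N j - 1)
      rw [Nat.sub_add_cancel hpos] at this
      linarith
  have hSm : ∀ n, Measurable (S n) := fun n =>
    Finset.measurable_fun_sum _ fun k _ => (hYmeas k).sub_const _
  have hinc : ∀ i j : ℕ, i < j → ∫⁻ ω, ENNReal.ofReal ((S (N j) ω - S (N i) ω) ^ 2) ∂P ≤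
      ENNReal.ofReal (2 * C₁ * ((j : ℝ) - i)) := by
    intro i j hij
    have hij' : (i : ℝ) + 1 ≤ j := by exact_mod_cast hij
    have hNij : N i ≤ N j := hNle (by linarith [hN1 j])
    rcases hNij.eq_or_lt with heq | hlt
    · simp [heq]
    · have h1 : ∀ ω, S (N j) ω - S (N i) ω =
          ∑ k ∈ Finset.Icc (N i + 1) (N j), (Y k ω - y k) := fun ω => by
        have := hsplit (fun k => Y k ω - y k) hNij
        simp only [S]
        linarith
      simp_rw [h1]
      refine (hvar _ _ (Nat.le_add_left 1 _) hlt).trans (ENNReal.ofReal_le_ofReal ?_)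
      have h2 : ∑ k ∈ Finset.Icc (N i + 1) (N j), y k = Φ (N j) - Φ (N i) := by
        have := hsplit y hNij
        simp only [hΦ]
        linarith
      rw [h2, mul_comm 2 C₁, mul_assoc]
      refine mul_le_mul_of_nonneg_left ?_ (by linarith)
      linarith [hN1 i, hN2 j]
  filter_upwards [ae_exists_forall_abs_sub_zero_le P (fun j => S (N j)) (fun j => hSm _)
    (by linarith : 0 ≤ 2 * C₁) hinc] with ω hω
  obtain ⟨K, hK0, hK⟩ := hω
  have hS0 : S (N 0) ω = 0 := by simp [S, hN0]
  simp only [hS0, sub_zero] at hK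
  have hcomp : ∀ {m n : ℕ}, m ≤ n → S m ω + Φ m ≤ S n ω + Φ n := by
    intro m n hmn
    have h1 : ∀ n, S n ω + Φ n = ∑ k ∈ Finset.Icc 1 n, Y k ω := fun n => by
      simp [S, hΦ, Finset.sum_sub_distrib]
    rw [h1, h1, hsplit (fun k => Y k ω) hmn]
    linarith [Finset.sum_nonneg (s := Finset.Icc (m + 1) n) fun k _ => hYpos k ω]
  have hinterp : ∀ n, |S n ω| ≤ 2 + (|S (N ⌊Φ n⌋₊) ω| + |S (N (⌊Φ n⌋₊ + 1)) ω|) := by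
    intro n
    have hΦn : 0 ≤ Φ n := hΦ0 ▸ hΦmono n.zero_le
    have hfl := Nat.floor_le hΦn
    have hfl' := Nat.lt_floor_add_one (Φ n)
    set j := ⌊Φ n⌋₊
    have hup := hN1 (j + 1)
    have hup' := hN2 (j + 1)
    push_cast at hup hup'
    have hle : n ≤ N (j + 1) := by
      by_contra! hcon
      linarith [hΦmono hcon.le]
    have h1 := hcomp (hNle hfl)
    have h2 := hcomp hle
    have := hN1 j
    have := neg_abs_le (S (N j) ω)
    have := le_abs_self (S (N (j + 1)) ω)
    have := abs_nonneg (S (N j) ω)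
    have := abs_nonneg (S (N (j + 1)) ω)
    rw [abs_le]
    constructor <;> linarith
  have hA : 0 ≤ |S (N 1) ω| + |S (N 2) ω| := by positivity
  refine ⟨2 + 144 * K + (|S (N 1) ω| + |S (N 2) ω|), by linarith, fun n _ => ?_⟩
  change |S n ω| ≤ _ * max 1 (Real.sqrt (Φ n) * Real.log (Φ n) ^ 2)
  have hM1 := le_max_left 1 (Real.sqrt (Φ n) * Real.log (Φ n) ^ 2)
  have hM2 := le_max_right 1 (Real.sqrt (Φ n) * Real.log (Φ n) ^ 2)
  set M := max 1 (Real.sqrt (Φ n) * Real.log (Φ n) ^ 2)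
  refine (hinterp n).trans ?_
  rcases lt_or_ge (Φ n) 2 with hsmall | hbig
  · have hj : ⌊Φ n⌋₊ < 2 := (Nat.floor_lt' two_ne_zero).2 (by exact_mod_cast hsmall)
    have hb : |S (N ⌊Φ n⌋₊) ω| + |S (N (⌊Φ n⌋₊ + 1)) ω| ≤ |S (N 1) ω| + |S (N 2) ω| := by
      interval_cases ⌊Φ n⌋₊
      · simp [hS0]
      · exact le_rfl
    nlinarith
  · have hfl := Nat.floor_le (zero_le_two.trans hbig)
    set j := ⌊Φ n⌋₊
    have hr1 : j + 1 < 2 ^ (Nat.log 2 (j + 1) + 1) := Nat.lt_pow_succ_log_self one_lt_two _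
    have hr2 : ((2 ^ Nat.log 2 (j + 1) : ℕ) : ℝ) ≤ ((j + 1 : ℕ) : ℝ) :=
      Nat.cast_le.2 (Nat.pow_log_le_self 2 j.succ_ne_zero)
    set r := Nat.log 2 (j + 1) + 1 with hr
    have hr3 : (2 : ℝ) ^ r ≤ 4 * Φ n := by
      push_cast at hr2
      rw [hr, pow_succ]
      linarith
    have hbound : K * (Real.sqrt (2 ^ r) * ((r : ℝ) + 1) ^ 2) ≤ K * (72 * M) :=
      mul_le_mul_of_nonneg_left
        ((sqrt_two_pow_mul_sq_le hbig hr3).trans (by linarith)) hK0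
    have h1 := (hK r j (by omega)).trans hbound
    have h2 := (hK r (j + 1) hr1).trans hbound
    nlinarith
end

section
/- Let λ be a probability measure on Aff(ℝ) with a finite exponential moment such that supp λ has no global fixed point, and let σ be a λ-stationary Borel probability measure on ℝ. Then there exists a probability measure λ⁺ on Aff(ℝ) such that: λ⁺ is supported on orientation-preserving maps (r_φ > 0 for λ⁺-a.e. φ), λ⁺ has a finite exponential moment, supp λ⁺ has no global fixed point, and σ is λ⁺-stationary. -/
open MeasureTheory Filter Topology

/-- The affine group of ℝ, modeled as pairs `(r, b)` with `r ≠ 0`,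
acting by `t ↦ r * t + b`. -/
abbrev AffR : Type := {p : ℝ × ℝ // p.1 ≠ 0}

namespace AffR

/-- The action of an affine map on a real number. -/
def act (φ : AffR) (t : ℝ) : ℝ := φ.1.1 * t + φ.1.2

/-- Composition of affine maps. -/
def comp (φ ψ : AffR) : AffR :=
  ⟨(φ.1.1 * ψ.1.1, φ.1.1 * ψ.1.2 + φ.1.2), mul_ne_zero φ.2 ψ.2⟩

lemma act_comp (φ ψ : AffR) (t : ℝ) : act (comp φ ψ) t = act φ (act ψ t) := by
  simp only [act, comp]; ring

lemma preimage_act_comp (φ ψ : AffR) (A : Set ℝ) :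
    act (comp φ ψ) ⁻¹' A = act ψ ⁻¹' (act φ ⁻¹' A) := by
  ext t
  simp only [Set.mem_preimage, act_comp]

lemma measurable_comp : Measurable fun p : AffR × AffR => comp p.1 p.2 := by
  unfold comp
  apply Measurable.subtype_mk
  fun_prop

lemma measurable_act : Measurable fun p : AffR × ℝ => act p.1 p.2 := by
  unfold act; fun_prop

lemma continuous_act (t : ℝ) : Continuous fun φ : AffR => act φ t := by
  unfold act; fun_prop

lemma measurable_act_left (φ : AffR) : Measurable (act φ) := by
  unfold act; fun_prop

lemma measurable_measure_preimage (σ : Measure ℝ) [SFinite σ] {A : Set ℝ}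
    (hA : MeasurableSet A) : Measurable fun φ : AffR => σ (act φ ⁻¹' A) :=
  measurable_measure_prodMk_left (measurable_act hA)

/-- A function dominating the size of the coefficients of an affine map and its inverse. -/
noncomputable def size (φ : AffR) : ℝ := 1 + |φ.1.1| + |φ.1.2| + |φ.1.1|⁻¹

lemma measurable_size : Measurable size := by
  unfold size; fun_prop

lemma one_le_size (φ : AffR) : 1 ≤ size φ := by
  unfold size; linarith [abs_nonneg φ.1.1, abs_nonneg φ.1.2, inv_nonneg.2 (abs_nonneg φ.1.1)]

lemma size_pos (φ : AffR) : 0 < size φ := one_pos.trans_le (one_le_size φ)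

lemma size_comp_le (φ ψ : AffR) : size (comp φ ψ) ≤ size φ * size ψ := by
  have h := abs_add_le (φ.1.1 * ψ.1.2) φ.1.2
  simp only [size, comp, abs_mul, mul_inv] at h ⊢
  have a := abs_nonneg φ.1.1
  have b := abs_nonneg φ.1.2
  have c := inv_nonneg.2 a
  have a' := abs_nonneg ψ.1.1
  have b' := abs_nonneg ψ.1.2
  have c' := inv_nonneg.2 a'
  generalize |φ.1.1|⁻¹ = z at *
  generalize |ψ.1.1|⁻¹ = z' at *
  generalize |φ.1.1| = x at *
  generalize |ψ.1.1| = x' at *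
  generalize |φ.1.2| = y at *
  generalize |ψ.1.2| = y' at *
  refine (add_le_add_left (add_le_add_right h _) _).trans ?_
  rw [← sub_nonneg]
  ring_nf
  positivity

lemma moment_le_size {δ : ℝ} (hδ : 0 < δ) (φ : AffR) :
    |φ.1.1| ^ δ + |φ.1.1| ^ (-δ) + |φ.1.2| ^ δ ≤ 3 * size φ ^ δ := by
  have a := abs_nonneg φ.1.1
  have b := abs_nonneg φ.1.2
  have c := inv_nonneg.2 a
  rw [Real.rpow_neg a, ← Real.inv_rpow a]
  have h1 : |φ.1.1| ^ δ ≤ size φ ^ δ :=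
    Real.rpow_le_rpow a (by unfold size; linarith) hδ.le
  have h2 : |φ.1.1|⁻¹ ^ δ ≤ size φ ^ δ :=
    Real.rpow_le_rpow c (by unfold size; linarith) hδ.le
  have h3 : |φ.1.2| ^ δ ≤ size φ ^ δ :=
    Real.rpow_le_rpow b (by unfold size; linarith) hδ.le
  linarith

lemma size_rpow_le {ε : ℝ} (hε : 0 < ε) (φ : AffR) :
    size φ ^ ε ≤ 4 ^ ε * (1 + (|φ.1.1| ^ ε + |φ.1.1| ^ (-ε) + |φ.1.2| ^ ε)) := by
  have a := abs_nonneg φ.1.1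
  have b := abs_nonneg φ.1.2
  have c := inv_nonneg.2 a
  rw [Real.rpow_neg a, ← Real.inv_rpow a]
  have a' := Real.rpow_nonneg a ε
  have b' := Real.rpow_nonneg b ε
  have c' := Real.rpow_nonneg c ε
  have key : ∀ m : ℝ, 0 ≤ m → size φ ≤ 4 * m → size φ ^ ε ≤ 4 ^ ε * m ^ ε := fun m hm h => by
    rw [← Real.mul_rpow (by norm_num) hm]
    exact Real.rpow_le_rpow (size_pos φ).le h hε.le
  have four : (0 : ℝ) ≤ 4 ^ ε := by positivity
  have fin : ∀ m : ℝ, 0 ≤ m → size φ ≤ 4 * m →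
      m ^ ε ≤ 1 + (|φ.1.1| ^ ε + |φ.1.1|⁻¹ ^ ε + |φ.1.2| ^ ε) →
      size φ ^ ε ≤ 4 ^ ε * (1 + (|φ.1.1| ^ ε + |φ.1.1|⁻¹ ^ ε + |φ.1.2| ^ ε)) :=
    fun m hm h h' => (key m hm h).trans (mul_le_mul_of_nonneg_left h' four)
  by_cases h1 : size φ ≤ 4 * 1
  · exact fin 1 zero_le_one h1 (by rw [Real.one_rpow]; linarith)
  by_cases h2 : size φ ≤ 4 * |φ.1.1|
  · exact fin _ a h2 (by linarith)
  by_cases h3 : size φ ≤ 4 * |φ.1.2|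
  · exact fin _ b h3 (by linarith)
  · refine fin _ c ?_ (by linarith)
    unfold size at *
    linarith

/-- Convolution of measures on the affine group. -/
noncomputable def conv (μ ν : Measure AffR) : Measure AffR :=
  (μ.prod ν).map fun p => comp p.1 p.2

instance (μ ν : Measure AffR) [SFinite μ] [SFinite ν] : SFinite (conv μ ν) := by
  unfold conv; infer_instance

lemma lintegral_conv (μ ν : Measure AffR) [SFinite ν] {f : AffR → ENNReal}
    (hf : Measurable f) : ∫⁻ φ, f φ ∂conv μ ν = ∫⁻ φ, ∫⁻ ψ, f (comp φ ψ) ∂ν ∂μ := by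
  rw [conv, lintegral_map hf measurable_comp]
  exact lintegral_prod _ (hf.comp measurable_comp).aemeasurable

lemma ae_ae_of_ae_conv {μ ν : Measure AffR} [SFinite ν] {p : AffR → Prop}
    (h : ∀ᵐ φ ∂conv μ ν, p φ) : ∀ᵐ φ ∂μ, ∀ᵐ ψ ∂ν, p (comp φ ψ) :=
  Measure.ae_ae_of_ae_prod (ae_of_ae_map measurable_comp.aemeasurable h)

lemma ae_conv {μ ν : Measure AffR} [SFinite ν] {p : AffR → Prop}
    (hp : MeasurableSet {φ | p φ}) (h : ∀ᵐ φ ∂μ, ∀ᵐ ψ ∂ν, p (comp φ ψ)) :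
    ∀ᵐ φ ∂conv μ ν, p φ := by
  rw [conv, ae_map_iff measurable_comp.aemeasurable hp]
  exact (Measure.ae_prod_iff_ae_ae (measurable_comp hp)).2 h

lemma lintegral_size_conv_le (μ ν : Measure AffR) [SFinite ν] {δ : ℝ} (hδ : 0 < δ) :
    ∫⁻ φ, ENNReal.ofReal (size φ ^ δ) ∂conv μ ν ≤
      (∫⁻ φ, ENNReal.ofReal (size φ ^ δ) ∂μ) * ∫⁻ φ, ENNReal.ofReal (size φ ^ δ) ∂ν := by
  have hm : Measurable fun φ : AffR => ENNReal.ofReal (size φ ^ δ) :=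
    (measurable_size.pow_const δ).ennreal_ofReal
  rw [lintegral_conv μ ν hm, ← lintegral_mul_const _ hm]
  refine lintegral_mono fun φ => ?_
  rw [← lintegral_const_mul _ hm]
  refine lintegral_mono fun ψ => ?_
  rw [← ENNReal.ofReal_mul (Real.rpow_nonneg (size_pos φ).le _),
    ← Real.mul_rpow (size_pos φ).le (size_pos ψ).le]
  exact ENNReal.ofReal_le_ofReal
    (Real.rpow_le_rpow (size_pos _).le (size_comp_le φ ψ) hδ.le)

/-- The measure `μ * ⋯ * μ * ν` with `n` factors `μ`. -/
noncomputable def iterConv (μ ν : Measure AffR) : ℕ → Measure AffR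
  | 0 => ν
  | n + 1 => conv μ (iterConv μ ν n)

instance (μ ν : Measure AffR) [SFinite μ] [SFinite ν] (n : ℕ) : SFinite (iterConv μ ν n) := by
  induction n with
  | zero => simpa [iterConv]
  | succ n ih => rw [iterConv]; infer_instance

/-- The law of the product up to and including the first factor distributed like `ν`. -/
noncomputable def firstHit (μ ν : Measure AffR) : Measure AffR := Measure.sum (iterConv μ ν)

instance (μ ν : Measure AffR) [SFinite μ] [SFinite ν] : SFinite (firstHit μ ν) := by
  unfold firstHit; infer_instance

lemma lintegral_size_iterConv_le (μ ν : Measure AffR) [SFinite μ] [SFinite ν] {δ : ℝ}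
    (hδ : 0 < δ) (n : ℕ) :
    ∫⁻ φ, ENNReal.ofReal (size φ ^ δ) ∂iterConv μ ν n ≤
      (∫⁻ φ, ENNReal.ofReal (size φ ^ δ) ∂μ) ^ n *
        ∫⁻ φ, ENNReal.ofReal (size φ ^ δ) ∂ν := by
  induction n with
  | zero => simp [iterConv]
  | succ n ih =>
    refine (lintegral_size_conv_le _ _ hδ).trans ?_
    rw [pow_succ', mul_assoc]
    gcongr

lemma lintegral_size_firstHit_lt_top (μ ν : Measure AffR) [SFinite μ] [SFinite ν] {δ : ℝ}
    (hδ : 0 < δ) (hμ : ∫⁻ φ, ENNReal.ofReal (size φ ^ δ) ∂μ < 1)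
    (hν : ∫⁻ φ, ENNReal.ofReal (size φ ^ δ) ∂ν < ⊤) :
    ∫⁻ φ, ENNReal.ofReal (size φ ^ δ) ∂firstHit μ ν < ⊤ := by
  rw [firstHit, lintegral_sum_measure]
  refine (ENNReal.tsum_le_tsum (lintegral_size_iterConv_le μ ν hδ)).trans_lt ?_
  rw [ENNReal.tsum_mul_right, ENNReal.tsum_geometric]
  exact ENNReal.mul_lt_top (ENNReal.inv_lt_top.2 (tsub_pos_of_lt hμ)) hν

lemma exists_lintegral_size_lt_one {μ : Measure AffR} {ε : ℝ} (hε : 0 < ε)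
    (h : ∫⁻ φ, ENNReal.ofReal (size φ ^ ε) ∂μ < ⊤) (hμ : μ Set.univ < 1) :
    ∃ δ, 0 < δ ∧ δ ≤ ε ∧ ∫⁻ φ, ENNReal.ofReal (size φ ^ δ) ∂μ < 1 := by
  have hlim : Tendsto (fun n : ℕ => ε / ((n : ℝ) + 1)) atTop (𝓝 0) := by
    simpa [div_eq_mul_inv] using
      (tendsto_one_div_add_atTop_nhds_zero_nat (𝕜 := ℝ)).const_mul ε
  have hle : ∀ n : ℕ, ε / ((n : ℝ) + 1) ≤ ε := fun n =>
    div_le_self hε.le (by linarith [(Nat.cast_nonneg n : (0 : ℝ) ≤ n)])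
  have key : Tendsto (fun n : ℕ => ∫⁻ φ, ENNReal.ofReal (size φ ^ (ε / ((n : ℝ) + 1))) ∂μ)
      atTop (𝓝 (∫⁻ _, 1 ∂μ)) := by
    refine tendsto_lintegral_of_dominated_convergence
      (fun φ => ENNReal.ofReal (size φ ^ ε))
      (fun n => (measurable_size.pow_const _).ennreal_ofReal)
      (fun n => Eventually.of_forall fun φ => ENNReal.ofReal_le_ofReal
        (Real.rpow_le_rpow_of_exponent_le (one_le_size φ) (hle n))) h.ne
      (Eventually.of_forall fun φ => ?_)
    have := ENNReal.tendsto_ofReal (((Real.continuous_const_rpow (size_pos φ).ne').tendsto 0).comp hlim)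
    simpa using this
  rw [lintegral_one] at key
  obtain ⟨n, hn⟩ := (key.eventually_lt_const hμ).exists
  exact ⟨_, by positivity, hle n, hn⟩

lemma lintegral_moment_lt_top {μ : Measure AffR} {δ : ℝ} (hδ : 0 < δ)
    (h : ∫⁻ φ, ENNReal.ofReal (size φ ^ δ) ∂μ < ⊤) :
    ∫⁻ φ : AffR, ENNReal.ofReal (|φ.1.1| ^ δ + |φ.1.1| ^ (-δ) + |φ.1.2| ^ δ) ∂μ < ⊤ := by
  refine (lintegral_mono (g := fun φ => ENNReal.ofReal 3 * ENNReal.ofReal (size φ ^ δ))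
    fun φ => ?_).trans_lt ?_
  · dsimp only
    rw [← ENNReal.ofReal_mul (by norm_num)]
    exact ENNReal.ofReal_le_ofReal (moment_le_size hδ φ)
  · rw [lintegral_const_mul' _ _ ENNReal.ofReal_ne_top]
    exact ENNReal.mul_lt_top ENNReal.ofReal_lt_top h

lemma lintegral_size_lt_top {μ : Measure AffR} [IsFiniteMeasure μ] {ε : ℝ} (hε : 0 < ε)
    (h : ∫⁻ φ : AffR, ENNReal.ofReal (|φ.1.1| ^ ε + |φ.1.1| ^ (-ε) + |φ.1.2| ^ ε) ∂μ < ⊤) :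
    ∫⁻ φ, ENNReal.ofReal (size φ ^ ε) ∂μ < ⊤ := by
  refine (lintegral_mono (g := fun φ : AffR => ENNReal.ofReal (4 ^ ε) * (1 +
    ENNReal.ofReal (|φ.1.1| ^ ε + |φ.1.1| ^ (-ε) + |φ.1.2| ^ ε))) fun φ => ?_).trans_lt ?_
  · dsimp only
    rw [← ENNReal.ofReal_one, ← ENNReal.ofReal_add zero_le_one (by positivity),
      ← ENNReal.ofReal_mul (by positivity)]
    exact ENNReal.ofReal_le_ofReal (size_rpow_le hε φ)
  · rw [lintegral_const_mul' _ _ ENNReal.ofReal_ne_top, lintegral_add_left measurable_const,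
      lintegral_one]
    exact ENNReal.mul_lt_top ENNReal.ofReal_lt_top
      (ENNReal.add_lt_top.2 ⟨measure_lt_top _ _, h⟩)

lemma lintegral_measure_preimage_conv (σ : Measure ℝ) [SFinite σ] (μ ν : Measure AffR)
    [SFinite ν] {A : Set ℝ} (hA : MeasurableSet A) :
    ∫⁻ φ, σ (act φ ⁻¹' A) ∂conv μ ν =
      ∫⁻ φ, ∫⁻ ψ, σ (act ψ ⁻¹' (act φ ⁻¹' A)) ∂ν ∂μ := by
  rw [lintegral_conv _ _ (measurable_measure_preimage σ hA)]
  refine lintegral_congr fun φ => lintegral_congr fun ψ => ?_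
  rw [preimage_act_comp]

section Stationary

variable {σ : Measure ℝ} [IsProbabilityMeasure σ] {μ ν : Measure AffR} [SFinite μ] [SFinite ν]

lemma stationary_partial_sum
    (h : ∀ A, MeasurableSet A →
      σ A = ∫⁻ φ, σ (act φ ⁻¹' A) ∂μ + ∫⁻ φ, σ (act φ ⁻¹' A) ∂ν) (N : ℕ) :
    ∀ A, MeasurableSet A →
      ∑ n ∈ Finset.range N, ∫⁻ φ, σ (act φ ⁻¹' A) ∂iterConv μ ν n ≤ σ A ∧
      σ A ≤ ∑ n ∈ Finset.range N, ∫⁻ φ, σ (act φ ⁻¹' A) ∂iterConv μ ν n +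
        μ Set.univ ^ N := by
  induction N with
  | zero => intro A _; simpa using prob_le_one
  | succ N ih =>
    intro A hA
    have hsum : ∑ n ∈ Finset.range (N + 1), ∫⁻ φ, σ (act φ ⁻¹' A) ∂iterConv μ ν n =
        ∫⁻ φ, ∑ n ∈ Finset.range N,
          ∫⁻ ψ, σ (act ψ ⁻¹' (act φ ⁻¹' A)) ∂iterConv μ ν n ∂μ +
        ∫⁻ φ, σ (act φ ⁻¹' A) ∂ν := by
      rw [Finset.sum_range_succ', lintegral_finsetSum]
      · congr 1
        exact Finset.sum_congr rfl fun n _ => lintegral_measure_preimage_conv σ _ _ hA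
      · intro n _
        have hm : Measurable fun p : AffR × AffR => σ (act (comp p.1 p.2) ⁻¹' A) :=
          (measurable_measure_preimage σ hA).comp measurable_comp
        have := hm.lintegral_prod_right' (ν := iterConv μ ν n)
        simpa only [preimage_act_comp] using this
    rw [hsum, h A hA]
    have hpre := fun φ => ih _ (measurable_act_left φ hA)
    constructor
    · gcongr with φ
      exact (hpre φ).1
    · calc ∫⁻ φ, σ (act φ ⁻¹' A) ∂μ + ∫⁻ φ, σ (act φ ⁻¹' A) ∂ν
          ≤ ∫⁻ φ, (∑ n ∈ Finset.range N,
              ∫⁻ ψ, σ (act ψ ⁻¹' (act φ ⁻¹' A)) ∂iterConv μ ν n + μ Set.univ ^ N) ∂μ +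
            ∫⁻ φ, σ (act φ ⁻¹' A) ∂ν := by
            gcongr with φ
            exact (hpre φ).2
        _ = _ := by
            rw [lintegral_add_right _ measurable_const, lintegral_const, ← pow_succ]
            ring

lemma stationary_firstHit (hμ : μ Set.univ < 1)
    (h : ∀ A, MeasurableSet A →
      σ A = ∫⁻ φ, σ (act φ ⁻¹' A) ∂μ + ∫⁻ φ, σ (act φ ⁻¹' A) ∂ν)
    {A : Set ℝ} (hA : MeasurableSet A) :
    σ A = ∫⁻ φ, σ (act φ ⁻¹' A) ∂firstHit μ ν := by
  rw [firstHit, lintegral_sum_measure]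
  have hs := (ENNReal.summable
    (f := fun n => ∫⁻ φ, σ (act φ ⁻¹' A) ∂iterConv μ ν n)).hasSum.tendsto_sum_nat
  have hp := ENNReal.tendsto_pow_atTop_nhds_zero_of_lt_one hμ
  refine le_antisymm ?_ (le_of_tendsto' hs fun N => (stationary_partial_sum h N A hA).1)
  have := hs.add hp
  rw [add_zero] at this
  exact ge_of_tendsto' this fun N => (stationary_partial_sum h N A hA).2

lemma stationary_firstReturn (hμ : μ Set.univ < 1)
    (h : ∀ A, MeasurableSet A →
      σ A = ∫⁻ φ, σ (act φ ⁻¹' A) ∂μ + ∫⁻ φ, σ (act φ ⁻¹' A) ∂ν)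
    {A : Set ℝ} (hA : MeasurableSet A) :
    σ A = ∫⁻ φ, σ (act φ ⁻¹' A) ∂(μ + conv ν (firstHit μ ν)) := by
  rw [lintegral_add_measure, lintegral_measure_preimage_conv σ _ _ hA, h A hA]
  congr 1
  exact lintegral_congr fun φ => stationary_firstHit hμ h (measurable_act_left φ hA)

end Stationary

lemma ae_firstHit_neg {μ ν : Measure AffR} [SFinite μ] [SFinite ν]
    (hμ : ∀ᵐ φ ∂μ, 0 < φ.1.1) (hν : ∀ᵐ φ ∂ν, φ.1.1 < 0) :
    ∀ᵐ φ ∂firstHit μ ν, φ.1.1 < 0 := by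
  rw [firstHit, Measure.ae_sum_iff' (measurableSet_lt (by fun_prop) measurable_const)]
  intro n
  induction n with
  | zero => exact hν
  | succ n ih =>
    refine ae_conv (measurableSet_lt (by fun_prop) measurable_const) ?_
    filter_upwards [hμ] with φ hφ
    filter_upwards [ih] with ψ hψ
    exact mul_neg_of_pos_of_neg hφ hψ

lemma exists_ae_fixed_of_firstReturn {μ ν : Measure AffR} [SFinite μ] [SFinite ν]
    (hν : ν ≠ 0) {t : ℝ} (h : ∀ᵐ φ ∂(μ + conv ν (firstHit μ ν)), act φ t = t) :
    ∃ m, ∀ᵐ φ ∂(μ + ν), act φ m = m := by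
  have : NeZero ν := ⟨hν⟩
  rw [ae_add_measure_iff] at h
  obtain ⟨hμt, h⟩ := h
  have h' := ae_ae_of_ae_conv h
  have hn : ∀ n, ∀ᵐ φ ∂ν, ∀ᵐ ψ ∂iterConv μ ν n, act φ (act ψ t) = t := fun n => by
    filter_upwards [h'] with φ hφ
    have := (ae_mono (Measure.le_sum (iterConv μ ν) n)) hφ
    filter_upwards [this] with ψ hψ
    rwa [← act_comp]
  have h0 : ∀ᵐ φ ∂ν, ∀ᵐ ψ ∂ν, act φ (act ψ t) = t := hn 0
  have h1 : ∀ᵐ φ ∂ν, ∀ᵐ χ ∂μ, ∀ᵐ ψ ∂ν, act φ (act χ (act ψ t)) = t := by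
    filter_upwards [hn 1] with φ hφ
    filter_upwards [ae_ae_of_ae_conv hφ] with χ hχ
    filter_upwards [hχ] with ψ hψ
    rwa [← act_comp χ ψ]
  obtain ⟨φ, hφ0, hφ1⟩ := (h0.and h1).exists
  have hinj : ∀ x y, act φ x = act φ y → x = y := fun x y hxy => by
    simpa [act, φ.2] using hxy
  obtain ⟨ψ, hψ⟩ := hφ0.exists
  have hs : ∀ᵐ χ ∂ν, act χ t = act ψ t := by
    filter_upwards [hφ0] with χ hχ
    exact hinj _ _ (hχ.trans hψ.symm)
  generalize act ψ t = s at hψ hs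
  have hs' : ∀ᵐ χ ∂ν, act χ s = t := by
    filter_upwards [h0] with χ hχ
    obtain ⟨ψ', h2, h3⟩ := (hχ.and hs).exists
    rwa [h3] at h2
  have hμs : ∀ᵐ χ ∂μ, act χ s = s := by
    filter_upwards [hφ1] with χ hχ
    obtain ⟨ψ', h2, h3⟩ := (hχ.and hs).exists
    rw [h3] at h2
    exact hinj _ _ (h2.trans hψ.symm)
  refine ⟨(s + t) / 2, ae_add_measure_iff.2 ⟨?_, ?_⟩⟩
  · filter_upwards [hμs, hμt] with χ h2 h3
    simp only [act] at *
    linarith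
  · filter_upwards [hs, hs'] with χ h2 h3
    simp only [act] at *
    linarith

end AffR

/-- A property holds almost everywhere when it holds on the support, in a second-countable
space. -/
lemma ae_of_forall_mem_msupport {α : Type*} [TopologicalSpace α] [SecondCountableTopology α]
    [MeasurableSpace α] {μ : Measure α} {p : α → Prop} (h : ∀ x ∈ msupport μ, p x) :
    ∀ᵐ x ∂μ, p x := by
  refine measure_null_of_locally_null _ fun x hx => ?_
  have hx' : x ∉ msupport μ := fun h' => hx (h x h')
  simp only [msupport, Set.mem_ofPred_eq, not_forall, not_lt, nonpos_iff_eq_zero] at hx'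
  obtain ⟨U, hU, hxU, h0⟩ := hx'
  exact ⟨U, mem_nhdsWithin_of_mem_nhds (hU.mem_nhds hxU), h0⟩

lemma forall_mem_msupport_of_ae {α : Type*} [TopologicalSpace α] [MeasurableSpace α]
    {μ : Measure α} {p : α → Prop} (hp : IsClosed {x | p x}) (h : ∀ᵐ x ∂μ, p x) :
    ∀ x ∈ msupport μ, p x := by
  intro x hx
  by_contra hpx
  exact (hx _ hp.isOpen_compl hpx).ne' h

/-- Reduction to orientation-preserving affine maps: any stationary measure of a measure
on `Aff(ℝ)` with finite exponential moment and no global fixed point is also stationary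
for such a measure supported on orientation-preserving maps. -/
theorem reduction_to_orientation_preserving
    (lam : Measure AffR) [IsProbabilityMeasure lam]
    (hmom : ∃ ε : ℝ, 0 < ε ∧
      ∫⁻ φ : AffR, ENNReal.ofReal (|φ.1.1| ^ ε + |φ.1.1| ^ (-ε) + |φ.1.2| ^ ε) ∂lam < ⊤)
    (hnofix : ¬ ∃ t : ℝ, ∀ φ ∈ msupport lam, φ.1.1 * t + φ.1.2 = t)
    (σ : Measure ℝ) [IsProbabilityMeasure σ]
    (hstat : ∀ A : Set ℝ, MeasurableSet A →
      σ A = ∫⁻ φ : AffR, σ ((fun t => φ.1.1 * t + φ.1.2) ⁻¹' A) ∂lam) :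
    ∃ lamp : Measure AffR, IsProbabilityMeasure lamp ∧
      (∀ᵐ φ ∂lamp, 0 < φ.1.1) ∧
      (∃ ε : ℝ, 0 < ε ∧
        ∫⁻ φ : AffR, ENNReal.ofReal (|φ.1.1| ^ ε + |φ.1.1| ^ (-ε) + |φ.1.2| ^ ε) ∂lamp < ⊤) ∧
      (¬ ∃ t : ℝ, ∀ φ ∈ msupport lamp, φ.1.1 * t + φ.1.2 = t) ∧
      (∀ A : Set ℝ, MeasurableSet A →
        σ A = ∫⁻ φ : AffR, σ ((fun t => φ.1.1 * t + φ.1.2) ⁻¹' A) ∂lamp) := by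
  set P : Set AffR := {φ | 0 < φ.1.1}
  have hP : MeasurableSet P := measurableSet_lt measurable_const (by fun_prop)
  have hadd : lam.restrict P + lam.restrict Pᶜ = lam := Measure.restrict_add_restrict_compl hP
  have hpos : ∀ᵐ φ ∂lam.restrict P, 0 < φ.1.1 := ae_restrict_mem hP
  by_cases hq : lam.restrict Pᶜ = 0
  · rw [hq, add_zero] at hadd
    rw [hadd] at hpos
    exact ⟨lam, inferInstance, hpos, hmom, hnofix, hstat⟩
  have hneg : ∀ᵐ φ ∂lam.restrict Pᶜ, φ.1.1 < 0 := by
    filter_upwards [ae_restrict_mem hP.compl] with φ hφ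
    exact lt_of_le_of_ne (not_lt.1 hφ) φ.2
  have hlt : lam.restrict P Set.univ < 1 := by
    rw [Measure.restrict_apply_univ]
    refine lt_of_le_of_ne prob_le_one fun h => hq ?_
    rw [Measure.restrict_eq_zero]
    exact (prob_compl_eq_zero_iff hP).2 h
  have hstat' : ∀ A, MeasurableSet A → σ A =
      ∫⁻ φ, σ (AffR.act φ ⁻¹' A) ∂lam.restrict P +
        ∫⁻ φ, σ (AffR.act φ ⁻¹' A) ∂lam.restrict Pᶜ := fun A hA => by
    rw [← lintegral_add_measure, hadd]
    exact hstat A hA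
  have hres : ∀ A, MeasurableSet A → σ A = ∫⁻ φ, σ (AffR.act φ ⁻¹' A)
      ∂(lam.restrict P + AffR.conv (lam.restrict Pᶜ)
        (AffR.firstHit (lam.restrict P) (lam.restrict Pᶜ))) :=
    fun A hA => AffR.stationary_firstReturn hlt hstat' hA
  refine ⟨lam.restrict P + AffR.conv (lam.restrict Pᶜ)
    (AffR.firstHit (lam.restrict P) (lam.restrict Pᶜ)), ⟨?_⟩, ?_, ?_, ?_, hres⟩
  · simpa using (hres _ MeasurableSet.univ).symm
  · refine ae_add_measure_iff.2 ⟨hpos, AffR.ae_conv hP ?_⟩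
    filter_upwards [hneg] with φ hφ
    filter_upwards [AffR.ae_firstHit_neg hpos hneg] with ψ hψ
    exact mul_pos_of_neg_of_neg hφ hψ
  · obtain ⟨ε, hε, hfin⟩ := hmom
    have hsize := AffR.lintegral_size_lt_top hε hfin
    obtain ⟨δ, hδ, hδε, h1⟩ := AffR.exists_lintegral_size_lt_one hε
      ((lintegral_mono' Measure.restrict_le_self le_rfl).trans_lt hsize) hlt
    have h2 : ∫⁻ φ, ENNReal.ofReal (AffR.size φ ^ δ) ∂lam.restrict Pᶜ < ⊤ :=
      (lintegral_mono' Measure.restrict_le_self fun φ => ENNReal.ofReal_le_ofReal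
        (Real.rpow_le_rpow_of_exponent_le (AffR.one_le_size φ) hδε)).trans_lt hsize
    refine ⟨δ, hδ, AffR.lintegral_moment_lt_top hδ ?_⟩
    rw [lintegral_add_measure]
    exact ENNReal.add_lt_top.2 ⟨h1.trans ENNReal.one_lt_top,
      (AffR.lintegral_size_conv_le _ _ hδ).trans_lt
        (ENNReal.mul_lt_top h2 (AffR.lintegral_size_firstHit_lt_top _ _ hδ h1 h2))⟩
  · rintro ⟨t, ht⟩
    obtain ⟨m, hm⟩ := AffR.exists_ae_fixed_of_firstReturn hq (ae_of_forall_mem_msupport ht)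
    rw [hadd] at hm
    exact hnofix ⟨m, forall_mem_msupport_of_ae
      (isClosed_eq (AffR.continuous_act m) continuous_const) hm⟩
end
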